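/- arXiv:2509.25997 — 2 statements merged into one kernel-verified Lean document; each statement's English description precedes it below -/
import Mathlib

section
/- Let d ≥ 2, let q be an odd prime power, let P be a set of points in F_q^d, and let S be a set of ‖·‖-spheres in F_q^d all having the same radius r ≠ 0. Then |I(P,S) − q^{−1}|P||S|| ≤ 2·√(q^{d−1}|P||S|). -/
open Finset

section Defs
variable {F : Type*} [Field F] [Fintype F] [DecidableEq F]

/-- `x₁x₂ + x₃x₄ + ⋯` : the sum of the first `k` products of consecutive pairs
of coordinates. -/
def pairsForm {d : ℕ} (k : ℕ) (x : Fin d → F) : F :=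
  ∑ j ∈ Finset.range k, if h : 2*j+1 < d then x ⟨2*j, by omega⟩ * x ⟨2*j+1, h⟩ else 0

/-- `Q₁^d(x) = x₁x₂ + x₃x₄ + ⋯ + x_{d−1}x_d` (for even `d`). -/
def Q1form {d : ℕ} (x : Fin d → F) : F := pairsForm (d/2) x

/-- `Q₂^d(x) = x₁x₂ + ⋯ + x_{d−3}x_{d−2} + x_{d−1}² − a·x_d²` (for even `d`,
`a` a non-square). -/
def Q2form (a : F) {d : ℕ} (x : Fin d → F) : F :=
  pairsForm ((d-2)/2) x +
    (if h : 2 ≤ d then x ⟨d-2, by omega⟩ ^ 2 - a * x ⟨d-1, by omega⟩ ^ 2 else 0)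

/-- `Q₃^d(x) = x₁x₂ + ⋯ + x_{d−2}x_{d−1} − x_d²` (for odd `d`). -/
def Q3form {d : ℕ} (x : Fin d → F) : F :=
  pairsForm ((d-1)/2) x - (if h : 1 ≤ d then x ⟨d-1, by omega⟩ ^ 2 else 0)

/-- `Q₄^d(x) = x₁x₂ + ⋯ + x_{d−2}x_{d−1} − a·x_d²` (for odd `d`, `a` a non-square). -/
def Q4form (a : F) {d : ℕ} (x : Fin d → F) : F :=
  pairsForm ((d-1)/2) x - (if h : 1 ≤ d then a * x ⟨d-1, by omega⟩ ^ 2 else 0)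

/-- The quadratic form `Q_i^d`. -/
def Qi (a : F) (i : ℕ) {d : ℕ} (x : Fin d → F) : F :=
  if i = 1 then Q1form x else if i = 2 then Q2form a x
  else if i = 3 then Q3form x else Q4form a x

/-- `‖x‖ = x₁² + ⋯ + x_d²`. -/
def normForm {d : ℕ} (x : Fin d → F) : F := ∑ i, x i ^ 2

/-- `I(P,S)`: the number of incidences between a set `P` of points and a set `S`
of `Qf`-spheres, each sphere given as a (center, radius) pair. -/
def sphIncid {d : ℕ} (Qf : (Fin d → F) → F)
    (P : Finset (Fin d → F)) (S : Finset ((Fin d → F) × F)) : ℕ :=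
  ((P ×ˢ S).filter fun z => Qf (z.1 - z.2.1) = z.2.2).card

/-- The set of points of the `Qf`-sphere `s` (given as a (center, radius) pair). -/
def spherePts {d : ℕ} (Qf : (Fin d → F) → F) (s : (Fin d → F) × F) : Finset (Fin d → F) :=
  Finset.univ.filter fun x => Qf (x - s.1) = s.2

end Defs

section Stepanov
open Polynomial

theorem eq_zero_of_squarefree_mul_sq_eq {F : Type*} [Field F] {f : F[X]} (hf : Squarefree f)
    (hdeg : 0 < f.natDegree) {k : F} (hk : k ≠ 0) (a b : F[X])
    (h : f * a ^ 2 = C k * b ^ 2) : a = 0 ∧ b = 0 := by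
  have hf0 : f ≠ 0 := by rintro rfl; simp at hdeg
  have hC : (C k : F[X]) ≠ 0 := by simpa using hk
  suffices ha : a = 0 by
    subst ha
    simpa [hk] using h.symm
  induction hn : a.natDegree using Nat.strong_induction_on generalizing a b with
  | _ n ih =>
    by_contra ha
    have hu : IsUnit (C k : F[X]) := by simpa using hk
    obtain ⟨b', rfl⟩ : f ∣ b := by
      rw [← hf.dvd_pow_iff_dvd two_ne_zero, ← hu.dvd_mul_left, ← h]
      exact dvd_mul_right _ _
    have h2 : a ^ 2 = C k * f * b' ^ 2 := mul_left_cancel₀ hf0 (by linear_combination h)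
    obtain ⟨a', rfl⟩ : f ∣ a := by
      rw [← hf.dvd_pow_iff_dvd two_ne_zero, h2]
      exact ⟨C k * b' ^ 2, by ring⟩
    have h3 : f * a' ^ 2 = C k * b' ^ 2 := mul_left_cancel₀ hf0 (by linear_combination h2)
    have ha' : a' ≠ 0 := right_ne_zero_of_mul ha
    exact ha' (ih a'.natDegree (by rw [← hn, natDegree_mul hf0 ha']; omega) a' b' h3 rfl)

theorem X_pow_dvd_pow_sub_C {F : Type*} [Field F] {p : ℕ} [Fact p.Prime] [CharP F p] (μ : ℕ)
    (f : F[X]) : (X : F[X]) ^ p ^ μ ∣ f ^ p ^ μ - C (f.eval 0 ^ p ^ μ) := by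
  have h : (X : F[X]) ∣ f - C (f.eval 0) := by
    rw [X_dvd_iff]; simp [coeff_zero_eq_eval_zero]
  rw [C_pow, ← sub_pow_char_pow]
  exact pow_dvd_pow_of_dvd h _

/-- The lacunary polynomial `∑ (aⱼ + bⱼ f ^ n) X ^ (j q)` with `q = 2 n + 1` and small `aⱼ`, `bⱼ`
vanishes only if all `aⱼ` and `bⱼ` do. -/
theorem eq_zero_of_lacunary_sum_eq_zero {F : Type*} [Field F] {p : ℕ} [Fact p.Prime] [CharP F p]
    {μ n : ℕ} (hq : p ^ μ = 2 * n + 1) {f : F[X]} (hf : Squarefree f) (hdeg : 0 < f.natDegree)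
    (hf0 : f.eval 0 ≠ 0) {D : ℕ} (hD : f.natDegree + 2 * D < p ^ μ) (J : ℕ) (a b : ℕ → F[X])
    (ha : ∀ j, (a j).natDegree ≤ D) (hb : ∀ j, (b j).natDegree ≤ D)
    (h : ∑ j ∈ range J, (a j + b j * f ^ n) * X ^ (p ^ μ * j) = 0) :
    ∀ j < J, a j = 0 ∧ b j = 0 := by
  induction J generalizing a b with
  | zero => simp
  | succ J ih =>
    set q := p ^ μ
    set U := ∑ j ∈ range J, a (j + 1) * X ^ (q * j)
    set V := ∑ j ∈ range J, b (j + 1) * X ^ (q * j)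
    have hUV : ∑ j ∈ range J, (a (j + 1) + b (j + 1) * f ^ n) * X ^ (q * j) = U + V * f ^ n := by
      simp only [U, V, Finset.sum_mul, ← Finset.sum_add_distrib]
      exact Finset.sum_congr rfl fun j _ => by ring
    have hshift : ∑ j ∈ range J, (a (j + 1) + b (j + 1) * f ^ n) * X ^ (q * (j + 1))
        = X ^ q * (U + V * f ^ n) := by
      rw [← hUV, Finset.mul_sum]
      exact Finset.sum_congr rfl fun j _ => by ring
    rw [Finset.sum_range_succ', hshift, mul_zero, pow_zero, mul_one] at h
    have hsq : f * (a 0 + X ^ q * U) ^ 2 = f ^ q * (b 0 + X ^ q * V) ^ 2 := by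
      have : a 0 + X ^ q * U = -((b 0 + X ^ q * V) * f ^ n) := by linear_combination h
      rw [this, hq]; ring
    obtain ⟨g, hg⟩ := X_pow_dvd_pow_sub_C (p := p) μ f
    have hdvd : X ^ q ∣ f * a 0 ^ 2 - C (f.eval 0 ^ q) * b 0 ^ 2 := by
      refine ⟨g * b 0 ^ 2 + f ^ q * (2 * b 0 * V + X ^ q * V ^ 2)
        - f * (2 * a 0 * U + X ^ q * U ^ 2), ?_⟩
      linear_combination hsq + b 0 ^ 2 * hg
    have hzero : f * a 0 ^ 2 - C (f.eval 0 ^ q) * b 0 ^ 2 = 0 := by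
      by_contra hne
      have h1 := natDegree_le_of_dvd hdvd hne
      rw [natDegree_X_pow] at h1
      have h2 : (f * a 0 ^ 2).natDegree ≤ f.natDegree + 2 * D :=
        natDegree_mul_le.trans (Nat.add_le_add_left
          (natDegree_pow_le.trans (Nat.mul_le_mul_left _ (ha 0))) _)
      have h3 : (C (f.eval 0 ^ q) * b 0 ^ 2).natDegree ≤ f.natDegree + 2 * D :=
        (natDegree_C_mul_le _ _).trans ((natDegree_pow_le.trans
          (Nat.mul_le_mul_left _ (hb 0))).trans (Nat.le_add_left _ _))
      have h4 := natDegree_sub_le_of_le h2 h3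
      rw [max_self] at h4
      omega
    obtain ⟨ha0, hb0⟩ := eq_zero_of_squarefree_mul_sq_eq hf hdeg (pow_ne_zero q hf0) _ _
      (sub_eq_zero.mp hzero)
    rw [ha0, hb0] at h
    have hrest : U + V * f ^ n = 0 := by simpa using h
    have := ih (fun j => a (j + 1)) (fun j => b (j + 1)) (fun j => ha _) (fun j => hb _)
      (hUV.trans hrest)
    rintro (_ | j) hj
    · exact ⟨ha0, hb0⟩
    · exact this j (by omega)

theorem card_degreeLT (F : Type*) [Field F] [Fintype F] (n : ℕ) :
    Nat.card (degreeLT F n) = Fintype.card F ^ n := by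
  rw [Nat.card_congr (degreeLTEquiv F n).toEquiv]; simp

instance (F : Type*) [Field F] [Fintype F] (n : ℕ) : Finite (degreeLT F n) :=
  Finite.of_equiv _ (degreeLTEquiv F n).toEquiv.symm

/-- A nonzero choice of coefficients for which the auxiliary polynomial vanishes at all points
where `f` is a nonzero square. -/
theorem exists_ne_zero_auxiliary {F : Type*} [Field F] [Fintype F] {p : ℕ} [Fact p.Prime]
    [CharP F p] {μ n : ℕ} (f : F[X]) {A J : ℕ}
    (hcard : f.natDegree * n + p ^ μ * (A - 1) + J < 2 * A * J) :
    ∃ a b : ℕ → F[X], (∀ j, (a j).natDegree ≤ A - 1) ∧ (∀ j, (b j).natDegree ≤ A - 1) ∧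
      (∃ j < J, ¬ (a j = 0 ∧ b j = 0)) ∧
      ∑ j ∈ range J, (f ^ n * a j ^ p ^ μ + b j ^ p ^ μ) * X ^ j = 0 := by
  set B := f.natDegree * n + p ^ μ * (A - 1) + J
  have hJ : 0 < J := by rcases J.eq_zero_or_pos with rfl | h <;> [simp at hcard; exact h]
  have hlt : ∀ g : degreeLT F A, (g : F[X]).natDegree ≤ A - 1 := fun g => by
    rcases eq_or_ne (g : F[X]) 0 with h | h
    · simp [h]
    · exact Nat.le_sub_one_of_lt ((natDegree_lt_iff_degree_lt h).mpr (mem_degreeLT.mp g.2))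
  let T : (Fin J → degreeLT F A × degreeLT F A) → degreeLT F B := fun v =>
    ⟨∑ j, (f ^ n * ((v j).1 : F[X]) ^ p ^ μ + ((v j).2 : F[X]) ^ p ^ μ) * X ^ (j : ℕ), by
      refine Submodule.sum_mem _ fun j _ => ?_
      rw [mem_degreeLT]
      refine degree_le_natDegree.trans_lt (Nat.cast_lt.mpr ?_)
      have h1 : (f ^ n * ((v j).1 : F[X]) ^ p ^ μ).natDegree
          ≤ f.natDegree * n + p ^ μ * (A - 1) :=
        natDegree_mul_le.trans (Nat.add_le_add (natDegree_pow_le.trans (mul_comm _ _).le)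
          (natDegree_pow_le.trans (Nat.mul_le_mul_left _ (hlt _))))
      have h2 : (((v j).2 : F[X]) ^ p ^ μ).natDegree ≤ f.natDegree * n + p ^ μ * (A - 1) :=
        (natDegree_pow_le.trans (Nat.mul_le_mul_left _ (hlt _))).trans (Nat.le_add_left _ _)
      have h3 := (natDegree_add_le_of_degree_le h1 h2)
      have h4 := natDegree_mul_le_of_le h3 (natDegree_X_pow_le (R := F) (j : ℕ))
      have := j.2
      omega⟩
  have hT : ¬ Function.Injective T := fun hinj => by
    have := Nat.card_le_card_of_injective T hinj
    rw [Nat.card_fun, Nat.card_prod, card_degreeLT, card_degreeLT, ← pow_add, Nat.card_fin,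
      ← pow_mul, Nat.pow_le_pow_iff_right Fintype.one_lt_card] at this
    rw [← two_mul] at this
    omega
  simp only [Function.Injective, not_forall] at hT
  obtain ⟨v, w, hvw, hne⟩ := hT
  have hvw := congrArg Subtype.val hvw
  let a : ℕ → F[X] := fun j => if h : j < J then ((v ⟨j, h⟩).1 - (w ⟨j, h⟩).1 : degreeLT F A) else 0
  let b : ℕ → F[X] := fun j => if h : j < J then ((v ⟨j, h⟩).2 - (w ⟨j, h⟩).2 : degreeLT F A) else 0
  refine ⟨a, b, fun j => ?_, fun j => ?_, ?_, ?_⟩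
  · by_cases h : j < J
    · simpa only [a, h, dite_true] using hlt _
    · simp [a, h]
  · by_cases h : j < J
    · simpa only [b, h, dite_true] using hlt _
    · simp [b, h]
  · by_contra! hcon
    refine hne (funext fun j => ?_)
    have := hcon j j.2
    simp only [a, b, j.2, dite_true, ZeroMemClass.coe_eq_zero, sub_eq_zero] at this
    exact Prod.ext this.1 this.2
  · rw [← Fin.sum_univ_eq_sum_range
      (fun j => (f ^ n * a j ^ p ^ μ + b j ^ p ^ μ) * X ^ j), ← sub_eq_zero.mpr hvw,
      ← Finset.sum_sub_distrib]
    refine Finset.sum_congr rfl fun j _ => ?_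
    simp only [a, b, j.2, dite_true, AddSubgroupClass.coe_sub, sub_pow_char_pow, Fin.eta]
    ring

theorem card_filter_pow_eq_one_le {F : Type*} [Field F] [Fintype F] [DecidableEq F] {p : ℕ}
    [Fact p.Prime] [CharP F p] {μ n e : ℕ} (hcard : Fintype.card F = (p ^ μ) ^ 2)
    (hq : p ^ μ = 2 * n + 1) {f : F[X]} (hf : Squarefree f) (hdeg : f.natDegree = 2 * e)
    (he : 0 < e) (hen : 2 * e ≤ n) (hf0 : f.eval 0 ≠ 0) :
    #{x : F | f.eval x ^ (n * (p ^ μ + 1)) = 1}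
      ≤ (n - e) + 2 * e * n + p ^ μ * (n + 2 * e - 1) := by
  set q := p ^ μ with hqdef
  obtain ⟨a, b, ha, hb, ⟨j₀, hj₀, hne⟩, hT⟩ :=
    exists_ne_zero_auxiliary (p := p) (μ := μ) (n := n) f (A := n + 1 - e) (J := n + 2 * e)
      (by
        rw [hdeg, ← hqdef, hq]
        obtain ⟨k, rfl⟩ := Nat.exists_eq_add_of_le hen
        rw [show 2 * e + k + 1 - e = e + k + 1 by omega, Nat.add_sub_cancel]
        nlinarith)
  rw [← hqdef] at hT
  have hA : n + 1 - e - 1 = n - e := by omega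
  rw [hA] at ha hb
  set R : F[X] := ∑ j ∈ range (n + 2 * e), (a j + b j * f ^ n) * X ^ (q * j) with hR
  have hR0 : R ≠ 0 := fun h0 => hne <|
    eq_zero_of_lacunary_sum_eq_zero hq hf (by omega) hf0 (D := n - e) (by omega) _ a b ha hb h0
      j₀ hj₀
  have hRdeg : R.natDegree ≤ (n - e) + 2 * e * n + q * (n + 2 * e - 1) := by
    refine natDegree_sum_le_of_forall_le _ _ fun j hj => ?_
    have h1 : (b j * f ^ n).natDegree ≤ (n - e) + 2 * e * n :=
      natDegree_mul_le.trans (Nat.add_le_add (hb j)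
        (natDegree_pow_le.trans (by rw [hdeg, mul_comm])))
    have h2 := natDegree_add_le_of_degree_le ((ha j).trans (Nat.le_add_right _ (2 * e * n))) h1
    refine natDegree_mul_le_of_le h2 ((natDegree_X_pow_le _).trans (Nat.mul_le_mul_left _ ?_))
    have := Finset.mem_range.mp hj
    omega
  have hroot : ∀ x : F, f.eval x ^ (n * (q + 1)) = 1 → R.eval x = 0 := fun x hx => by
    have hfx : f.eval x ≠ 0 := by
      intro h0
      rw [h0, zero_pow (Nat.mul_pos (by omega) (by omega)).ne'] at hx
      exact zero_ne_one hx
    have hxq : x ^ (q * q) = x := by rw [← sq, ← hcard]; exact FiniteField.pow_card x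
    have hT' := congrArg (eval x) hT
    simp only [eval_finsetSum, eval_mul, eval_add, eval_pow, eval_X, eval_zero] at hT'
    have hkey : f.eval x ^ n * R.eval x ^ q = 0 := by
      rw [← hT', hR, eval_finsetSum, hqdef, sum_pow_char_pow, ← hqdef, Finset.mul_sum]
      refine Finset.sum_congr rfl fun j _ => ?_
      simp only [eval_mul, eval_add, eval_pow, eval_X]
      rw [mul_pow, hqdef, add_pow_char_pow, ← hqdef, mul_pow, ← pow_mul x,
        show q * j * q = q * q * j by ring, pow_mul x, hxq]
      linear_combination (b j).eval x ^ q * x ^ j * hx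
    exact pow_eq_zero_iff (by omega) |>.mp ((mul_eq_zero.mp hkey).resolve_left (pow_ne_zero _ hfx))
  calc #{x : F | f.eval x ^ (n * (q + 1)) = 1} ≤ R.roots.toFinset.card := by
        refine Finset.card_le_card fun x hx => ?_
        rw [Multiset.mem_toFinset, mem_roots hR0]
        exact hroot x (by simpa using hx)
    _ ≤ R.roots.card := Multiset.toFinset_card_le _
    _ ≤ R.natDegree := card_roots' R
    _ ≤ _ := hRdeg

theorem ringChar_ne_two_of_odd_card {F : Type*} [Field F] [Fintype F]
    (hq : Odd (Fintype.card F)) : ringChar F ≠ 2 := fun h => by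
  rw [FiniteField.even_card_iff_char_two, ← Nat.even_iff] at h
  exact (Nat.not_even_iff_odd.mpr hq) h

theorem abs_sum_quadraticChar_eval_le {F : Type*} [Field F] [Fintype F] [DecidableEq F] {p : ℕ}
    [Fact p.Prime] [CharP F p] {μ e : ℕ} (hcard : Fintype.card F = (p ^ μ) ^ 2)
    (hodd : Odd (Fintype.card F)) {f : F[X]} (hf : Squarefree f) (hdeg : f.natDegree = 2 * e)
    (he : 0 < e) (hf0 : f.eval 0 ≠ 0) :
    |∑ x : F, quadraticChar F (f.eval x)| ≤ 10 * e * p ^ μ := by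
  have hF := ringChar_ne_two_of_odd_card hodd
  obtain ⟨n, hn⟩ : Odd (p ^ μ) := by
    rw [hcard, Nat.odd_pow_iff two_ne_zero] at hodd; exact hodd
  have hone : ∀ a : F, |quadraticChar F a| ≤ 1 := fun a => by
    rcases quadraticChar_isQuadratic F a with h | h | h <;> simp [h]
  rcases lt_or_ge n (2 * e) with hlt | hen
  · calc |∑ x : F, quadraticChar F (f.eval x)| ≤ ∑ x : F, |quadraticChar F (f.eval x)| :=
          Finset.abs_sum_le_sum_abs _ _
      _ ≤ ∑ _x : F, 1 := Finset.sum_le_sum fun x _ => hone _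
      _ = (p ^ μ : ℤ) * p ^ μ := by simp [hcard, sq]
      _ ≤ 10 * e * p ^ μ := by
          have : (p ^ μ : ℤ) ≤ 10 * e := by exact_mod_cast (by omega : p ^ μ ≤ 10 * e)
          gcongr
  have hhalf : Fintype.card F / 2 = n * (p ^ μ + 1) := by
    have : Fintype.card F = 2 * (n * (p ^ μ + 1)) + 1 := by rw [hcard, hn]; ring
    omega
  have hneg1 : (-1 : F) ≠ 1 := Ring.neg_one_ne_one_of_char_ne_two hF
  have hiff : ∀ a : F, quadraticChar F a = 1 ↔ a ^ (n * (p ^ μ + 1)) = 1 := fun a => by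
    rw [← hhalf, ← quadraticChar_eq_pow_of_char_ne_two' hF]
    rcases quadraticChar_isQuadratic F a with h | h | h <;> simp [h, hneg1]
  set M := (n - e) + 2 * e * n + p ^ μ * (n + 2 * e - 1) with hM
  have hbound : ∀ g : F[X], Squarefree g → g.natDegree = 2 * e → g.eval 0 ≠ 0 →
      #{x : F | quadraticChar F (g.eval x) = 1} ≤ M := fun g hg hg' hg0 => by
    simp only [hiff]
    exact card_filter_pow_eq_one_le hcard hn hg hg' he hen hg0
  obtain ⟨δ, hδ⟩ := quadraticChar_exists_neg_one hF
  have hδ0 : δ ≠ 0 := by rintro rfl; simp at hδ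
  have h1 := hbound f hf hdeg hf0
  have h2 := hbound (C δ * f)
    (hf.squarefree_of_dvd ((isUnit_C.mpr hδ0.isUnit).mul_left_dvd.mpr dvd_rfl))
    (by rw [natDegree_C_mul hδ0, hdeg]) (by simpa using ⟨hδ0, hf0⟩)
  simp only [eval_mul, eval_C, map_mul, hδ, neg_mul, one_mul, neg_eq_iff_eq_neg] at h2
  have h0 : #{x : F | quadraticChar F (f.eval x) = 0} ≤ 2 * e := by
    have hfne : f ≠ 0 := by rintro rfl; simp at hf0
    calc #{x : F | quadraticChar F (f.eval x) = 0} ≤ f.roots.toFinset.card :=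
          Finset.card_le_card fun x hx => by
            rw [Multiset.mem_toFinset, mem_roots hfne]
            exact quadraticChar_eq_zero_iff.mp (Finset.mem_filter.mp hx).2
      _ ≤ f.roots.card := Multiset.toFinset_card_le _
      _ ≤ 2 * e := hdeg ▸ card_roots' f
  have hsum : ∑ x : F, quadraticChar F (f.eval x)
      = (#{x : F | quadraticChar F (f.eval x) = 1} : ℤ)
        - #{x : F | quadraticChar F (f.eval x) = -1} := by
    simp only [Finset.card_filter, Nat.cast_sum, ← Finset.sum_sub_distrib]
    refine Finset.sum_congr rfl fun x _ => ?_
    rcases quadraticChar_isQuadratic F (f.eval x) with h | h | h <;> simp [h]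
  have htot : ((p : ℤ) ^ μ) ^ 2 = (#{x : F | quadraticChar F (f.eval x) = 0} : ℤ)
      + #{x : F | quadraticChar F (f.eval x) = 1}
      + #{x : F | quadraticChar F (f.eval x) = -1} := by
    have : ((p : ℤ) ^ μ) ^ 2 = ∑ _x : F, (1 : ℤ) := by simp [hcard]
    rw [this]
    simp only [Finset.card_filter, Nat.cast_sum, ← Finset.sum_add_distrib]
    refine Finset.sum_congr rfl fun x _ => ?_
    rcases quadraticChar_isQuadratic F (f.eval x) with h | h | h <;> simp [h]
  have hMle : (2 * M : ℤ) ≤ (p ^ μ) ^ 2 + 6 * e * p ^ μ := by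
    have hnz : (p ^ μ : ℤ) = 2 * n + 1 := by exact_mod_cast hn
    rw [hM]
    push_cast [Nat.cast_sub (by omega : e ≤ n), Nat.cast_sub (by omega : 1 ≤ n + 2 * e)]
    rw [hnz]
    nlinarith
  have hq1 : (1 : ℤ) ≤ p ^ μ := by exact_mod_cast (by omega : 1 ≤ p ^ μ)
  have heq : (e : ℤ) ≤ e * p ^ μ := le_mul_of_one_le_right (by positivity) hq1
  zify at h0 h1 h2
  rw [hsum, abs_le]
  constructor <;> linarith

end Stepanov

section Kloosterman

theorem two_ne_zero_of_odd_card {F : Type*} [Field F] [Fintype F]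
    (hq : Odd (Fintype.card F)) : (2 : F) ≠ 0 :=
  Ring.two_ne_zero (ringChar_ne_two_of_odd_card hq)

variable {F : Type*} [Field F] [Fintype F] [DecidableEq F]

/-- The Kloosterman sum `∑_{x ≠ 0} ψ (x + c / x)`. -/
noncomputable def kloostermanSum (ψ : AddChar F ℂ) (c : F) : ℂ :=
  ∑ x : F with x ≠ 0, ψ (x + c / x)

theorem card_sq_eq (hq : Odd (Fintype.card F)) (a : F) :
    (#{y : F | y ^ 2 = a} : ℤ) = quadraticChar F a + 1 := by
  rw [← quadraticChar_card_sqrts (ringChar_ne_two_of_odd_card hq) a]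
  congr 2
  ext; simp

theorem card_add_div_eq (hq : Odd (Fintype.card F)) {c : F} (hc : c ≠ 0) (t : F) :
    (#{x : F | x ≠ 0 ∧ x + c / x = t} : ℤ) = quadraticChar F (t ^ 2 - 4 * c) + 1 := by
  have h2 := two_ne_zero_of_odd_card hq
  rw [← card_sq_eq hq]
  congr 1
  refine Finset.card_bij' (fun x _ => 2 * x - t) (fun y _ => (y + t) / 2) ?_ ?_ ?_ ?_
  · intro x hx
    obtain ⟨hx0, rfl⟩ := (Finset.mem_filter.mp hx).2
    simp only [Finset.mem_filter, Finset.mem_univ, true_and]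
    field_simp
    ring
  · intro y hy
    have hy := (Finset.mem_filter.mp hy).2
    have hne : y + t ≠ 0 := fun h => by
      rw [eq_neg_of_add_eq_zero_left h] at hy
      have : 2 * (2 * c) = 0 := by linear_combination hy
      simp [h2, hc] at this
    simp only [Finset.mem_filter, Finset.mem_univ, true_and]
    refine ⟨div_ne_zero hne h2, ?_⟩
    field_simp
    linear_combination hy
  · intro x _; field_simp; ring
  · intro y _; field_simp; ring

theorem sum_add_div_eq (hq : Odd (Fintype.card F)) {c : F} (hc : c ≠ 0) (h : F → ℂ) :
    ∑ x : F with x ≠ 0, h (x + c / x)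
      = ∑ t : F, (quadraticChar F (t ^ 2 - 4 * c) + 1 : ℂ) * h t := by
  rw [← Finset.sum_fiberwise _ (fun x => x + c / x)]
  refine Finset.sum_congr rfl fun t _ => ?_
  rw [Finset.filter_filter,
    Finset.sum_congr rfl fun x hx => by rw [(Finset.mem_filter.mp hx).2.2],
    Finset.sum_const, nsmul_eq_mul]
  congr 1
  exact_mod_cast card_add_div_eq hq hc t

theorem kloostermanSum_eq_sum_quadraticChar (hq : Odd (Fintype.card F)) {ψ : AddChar F ℂ}
    (hψ : ψ ≠ 1) {c : F} (hc : c ≠ 0) :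
    kloostermanSum ψ c = ∑ t : F, (quadraticChar F (t ^ 2 - 4 * c) : ℂ) * ψ t := by
  simp only [kloostermanSum, sum_add_div_eq hq hc ψ, add_mul, one_mul, Finset.sum_add_distrib,
    AddChar.sum_eq_zero_of_ne_one hψ, add_zero]

end Kloosterman

section Kloosterman

variable {F : Type*} [Field F] [Fintype F] [DecidableEq F]

open Polynomial in
theorem abs_sum_quadraticChar_artinSchreier_le {p : ℕ} [Fact p.Prime] [CharP F p] {μ : ℕ}
    (hcard : Fintype.card F = (p ^ μ) ^ 2) (hodd : Odd (Fintype.card F)) {c : F} (hc : c ≠ 0)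
    {u : F} (hu : u ^ 2 ≠ 4 * c) :
    |∑ y : F, quadraticChar F ((u + (y ^ p - y)) ^ 2 - 4 * c)| ≤ 10 * p * p ^ μ := by
  have hp : 1 < p := (Fact.out : p.Prime).one_lt
  have h2 := two_ne_zero_of_odd_card hodd
  set w : F[X] := X ^ p - X + C u with hw
  have hwdeg : w.natDegree = p := by
    rw [hw, natDegree_add_C, natDegree_sub_eq_left_of_natDegree_lt] <;> simp [hp]
  have hwder : derivative w = -1 := by
    simp [hw, derivative_X_pow, CharP.cast_eq_zero]
  have hsqf : Squarefree (w ^ 2 - C (4 * c)) := by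
    refine Separable.squarefree ⟨-C ((4 * c)⁻¹), -C ((4 * c)⁻¹) * C 2⁻¹ * w, ?_⟩
    have h4 : (4 * c) ≠ 0 := by
      rw [show (4 : F) = 2 * 2 by norm_num]; simp [h2, hc]
    have hC4 : C ((4 * c)⁻¹) * C (4 * c) = (1 : F[X]) := by
      rw [← C_mul, inv_mul_cancel₀ h4, C_1]
    have hC2 : C (2⁻¹) * 2 = (1 : F[X]) := by
      rw [show (2 : F[X]) = C 2 from (map_ofNat C 2).symm, ← C_mul, inv_mul_cancel₀ h2, C_1]
    have hder : derivative (w ^ 2 - C (4 * c)) = 2 * w * (-1) := by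
      rw [derivative_sub, derivative_C, derivative_sq, hwder, C_ofNat, sub_zero]
    rw [hder]
    linear_combination hC4 + C ((4 * c)⁻¹) * w ^ 2 * hC2
  have hdeg : (w ^ 2 - C (4 * c)).natDegree = 2 * p := by
    rw [natDegree_sub_C, natDegree_pow, hwdeg]
  have h0 : (w ^ 2 - C (4 * c)).eval 0 ≠ 0 := by
    simp only [hw, eval_sub, eval_pow, eval_add, eval_X, eval_C, zero_pow (by omega : p ≠ 0)]
    rw [sub_zero, zero_add]
    exact sub_ne_zero.mpr hu
  refine le_of_eq_of_le ?_ (abs_sum_quadraticChar_eval_le hcard hodd hsqf hdeg (by omega) h0)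
  congr 1
  refine Finset.sum_congr rfl fun y _ => ?_
  simp only [hw, eval_sub, eval_pow, eval_add, eval_X, eval_C]
  congr 2
  ring

theorem norm_quadraticChar_le_one (a : F) : ‖(quadraticChar F a : ℂ)‖ ≤ 1 := by
  rcases quadraticChar_isQuadratic F a with h | h | h <;> simp [h]

theorem norm_kloostermanSum_le_of_card_eq_sq {p : ℕ} [Fact p.Prime] [CharP F p] {μ : ℕ}
    (hcard : Fintype.card F = (p ^ μ) ^ 2) (hodd : Odd (Fintype.card F)) {ψ : AddChar F ℂ}
    (hψ : ψ ≠ 1) (hfrob : ∀ y, ψ (y ^ p) = ψ y) {c : F} (hc : c ≠ 0) :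
    ‖kloostermanSum ψ c‖ ≤ 12 * p * p ^ μ := by
  set Q : ℝ := (Fintype.card F : ℝ) with hQ
  have hQpos : 0 < Q := by rw [hQ]; exact_mod_cast Fintype.card_pos
  have hAS : ∀ y, ψ (y ^ p - y) = 1 := fun y => by
    rw [AddChar.map_sub_eq_div, hfrob, div_self]
    exact fun h => by simpa [h] using AddChar.norm_apply ψ y
  have havg : (Q : ℂ) * kloostermanSum ψ c
      = ∑ u : F, ((∑ y : F, quadraticChar F ((u + (y ^ p - y)) ^ 2 - 4 * c) : ℤ) : ℂ) * ψ u := by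
    have h1 : ∀ y : F, kloostermanSum ψ c
        = ∑ u : F, (quadraticChar F ((u + (y ^ p - y)) ^ 2 - 4 * c) : ℂ) * ψ u := fun y => by
      rw [kloostermanSum_eq_sum_quadraticChar hodd hψ hc,
        ← Equiv.sum_comp (Equiv.addRight (y ^ p - y))]
      simp only [Equiv.coe_addRight, AddChar.map_add_eq_mul, hAS, mul_one]
    calc (Q : ℂ) * kloostermanSum ψ c = ∑ _y : F, kloostermanSum ψ c := by simp [hQ]
      _ = ∑ y : F, ∑ u : F, (quadraticChar F ((u + (y ^ p - y)) ^ 2 - 4 * c) : ℂ) * ψ u :=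
          Finset.sum_congr rfl fun y _ => h1 y
      _ = _ := by
          rw [Finset.sum_comm]
          simp only [Int.cast_sum, Finset.sum_mul]
  have hinner : ∀ u : F,
      ‖((∑ y : F, quadraticChar F ((u + (y ^ p - y)) ^ 2 - 4 * c) : ℤ) : ℂ) * ψ u‖
        ≤ 10 * p * p ^ μ + Q * (if u ^ 2 = 4 * c then 1 else 0) := fun u => by
    rw [norm_mul, AddChar.norm_apply, mul_one]
    by_cases hu : u ^ 2 = 4 * c
    · rw [if_pos hu, mul_one, Int.cast_sum]
      refine (norm_sum_le _ _).trans ?_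
      refine (Finset.sum_le_sum fun y _ => norm_quadraticChar_le_one _).trans ?_
      rw [Finset.sum_const, Finset.card_univ, nsmul_eq_mul, mul_one, ← hQ]
      have : (0 : ℝ) ≤ 10 * p * p ^ μ := by positivity
      linarith
    · rw [if_neg hu, mul_zero, add_zero, Complex.norm_intCast]
      exact_mod_cast abs_sum_quadraticChar_artinSchreier_le hcard hodd hc hu
  have htwo : (∑ u : F, if u ^ 2 = 4 * c then (1 : ℝ) else 0) ≤ 2 := by
    rw [Finset.sum_boole]
    have h := card_sq_eq hodd (4 * c)
    have h' : quadraticChar F (4 * c) ≤ 1 := by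
      rcases quadraticChar_isQuadratic F (4 * c) with h | h | h <;> simp [h]
    have : (#{u : F | u ^ 2 = 4 * c} : ℤ) ≤ 2 := by omega
    exact_mod_cast this
  have hfinal : Q * ‖kloostermanSum ψ c‖ ≤ Q * (12 * p * p ^ μ) := by
    calc Q * ‖kloostermanSum ψ c‖ = ‖(Q : ℂ) * kloostermanSum ψ c‖ := by
          rw [norm_mul, Complex.norm_real, Real.norm_of_nonneg hQpos.le]
      _ ≤ ∑ u : F, (10 * p * p ^ μ + Q * (if u ^ 2 = 4 * c then 1 else 0)) := by
          rw [havg]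
          exact (norm_sum_le _ _).trans (Finset.sum_le_sum fun u _ => hinner u)
      _ = Q * (10 * p * p ^ μ + ∑ u : F, if u ^ 2 = 4 * c then (1 : ℝ) else 0) := by
          rw [Finset.sum_add_distrib, Finset.sum_const, Finset.card_univ, nsmul_eq_mul, ← hQ,
            ← Finset.mul_sum, mul_add]
      _ ≤ Q * (12 * p * p ^ μ) := by
          have h1 : (1 : ℝ) ≤ p * p ^ μ := by
            exact_mod_cast Nat.mul_pos (Fact.out : p.Prime).pos
              (pow_pos (Fact.out : p.Prime).pos μ)
          gcongr
          linarith
  exact le_of_mul_le_mul_left hfinal hQpos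

theorem quadraticChar_div (a : F) {δ : F} (hδ : δ ≠ 0) :
    quadraticChar F (a / δ) = quadraticChar F δ * quadraticChar F a := by
  rw [show a / δ = δ * a * δ⁻¹ ^ 2 by field_simp, map_mul,
    quadraticChar_sq_one' (inv_ne_zero hδ), mul_one, map_mul]

theorem sum_norm_form_eq (hq : Odd (Fintype.card F)) (ψ : AddChar F ℂ) (c : F) {δ : F}
    (hδ : δ ≠ 0) :
    ∑ z : F × F with z.1 ^ 2 - δ * z.2 ^ 2 ≠ 0,
        ψ (2 * z.1 * (1 + c / (z.1 ^ 2 - δ * z.2 ^ 2)))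
      = ∑ u : F, ∑ n : F with n ≠ 0,
        (quadraticChar F δ * quadraticChar F (u ^ 2 - n) + 1 : ℂ) * ψ (2 * u * (1 + c / n)) := by
  rw [Finset.sum_filter, Fintype.sum_prod_type]
  refine Finset.sum_congr rfl fun u _ => ?_
  rw [← Finset.sum_fiberwise _ (fun v => u ^ 2 - δ * v ^ 2), Finset.sum_filter]
  refine Finset.sum_congr rfl fun n _ => ?_
  rw [Finset.sum_congr rfl fun v hv => by rw [(Finset.mem_filter.mp hv).2]]
  dsimp only
  rw [Finset.sum_const, nsmul_eq_mul]
  split_ifs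
  · congr 1
    have hset : #{v : F | u ^ 2 - δ * v ^ 2 = n} = #{v : F | v ^ 2 = (u ^ 2 - n) / δ} := by
      congr 1
      ext v
      simp only [Finset.mem_filter, Finset.mem_univ, true_and]
      rw [eq_div_iff hδ]
      constructor <;> intro h <;> linear_combination -h
    rw [hset]
    have h := card_sq_eq hq ((u ^ 2 - n) / δ)
    rw [quadraticChar_div _ hδ] at h
    exact_mod_cast h
  · rw [mul_zero]

theorem kloostermanSum_sq_eq (hq : Odd (Fintype.card F)) (ψ : AddChar F ℂ) (c : F) :
    kloostermanSum ψ c ^ 2 = ∑ z : F × F with z.1 ^ 2 - 1 * z.2 ^ 2 ≠ 0,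
        ψ (2 * z.1 * (1 + c / (z.1 ^ 2 - 1 * z.2 ^ 2))) := by
  have h2 := two_ne_zero_of_odd_card hq
  rw [sq, kloostermanSum, Finset.sum_mul_sum, ← Finset.sum_product']
  refine Finset.sum_bij' (fun z _ => ((z.1 + z.2) / 2, (z.1 - z.2) / 2))
    (fun z _ => (z.1 + z.2, z.1 - z.2)) ?_ ?_ ?_ ?_ ?_
  · rintro ⟨x, y⟩ hz
    simp only [Finset.mem_product, Finset.mem_filter, Finset.mem_univ, true_and] at hz ⊢
    rw [show ((x + y) / 2) ^ 2 - 1 * ((x - y) / 2) ^ 2 = x * y by field_simp; ring]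
    exact mul_ne_zero hz.1 hz.2
  · rintro ⟨x, y⟩ hz
    simp only [Finset.mem_product, Finset.mem_filter, Finset.mem_univ, true_and] at hz ⊢
    rw [show x ^ 2 - 1 * y ^ 2 = (x + y) * (x - y) by ring] at hz
    exact ⟨left_ne_zero_of_mul hz, right_ne_zero_of_mul hz⟩
  · rintro ⟨x, y⟩ _
    ext <;> simp <;> field_simp <;> ring
  · rintro ⟨x, y⟩ _
    ext <;> simp <;> field_simp <;> ring
  · rintro ⟨x, y⟩ hz
    simp only [Finset.mem_product, Finset.mem_filter, Finset.mem_univ, true_and] at hz ⊢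
    obtain ⟨hx, hy⟩ := hz
    rw [← AddChar.map_add_eq_mul,
      show ((x + y) / 2) ^ 2 - 1 * ((x - y) / 2) ^ 2 = x * y by field_simp; ring]
    congr 1
    field_simp
    ring

theorem kloostermanSum_sq_add_sum_norm_form (hq : Odd (Fintype.card F)) {ψ : AddChar F ℂ}
    (hψ : ψ ≠ 1) {c : F} (hc : c ≠ 0) {δ : F} (hδ : quadraticChar F δ = -1) :
    kloostermanSum ψ c ^ 2 + ∑ z : F × F with z.1 ^ 2 - δ * z.2 ^ 2 ≠ 0,
        ψ (2 * z.1 * (1 + c / (z.1 ^ 2 - δ * z.2 ^ 2))) = 2 * Fintype.card F := by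
  have h2 := two_ne_zero_of_odd_card hq
  have hδ0 : δ ≠ 0 := by rintro rfl; simp at hδ
  rw [kloostermanSum_sq_eq hq, sum_norm_form_eq hq ψ c one_ne_zero, sum_norm_form_eq hq ψ c hδ0,
    hδ, ← Finset.sum_add_distrib]
  simp only [← Finset.sum_add_distrib, map_one]
  have hterm : ∀ u n : F,
      ((1 : ℤ) * quadraticChar F (u ^ 2 - n) + 1 : ℂ) * ψ (2 * u * (1 + c / n))
        + ((-1 : ℤ) * quadraticChar F (u ^ 2 - n) + 1 : ℂ) * ψ (2 * u * (1 + c / n))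
      = 2 * ψ (u * (2 * (1 + c / n))) := fun u n => by
    rw [show u * (2 * (1 + c / n)) = 2 * u * (1 + c / n) by ring]
    push_cast
    ring
  simp only [hterm]
  rw [Finset.sum_comm]
  simp only [← Finset.mul_sum, AddChar.sum_mulShift _ (AddChar.IsPrimitive.of_ne_one hψ)]
  congr 1
  rw [Finset.sum_eq_single_of_mem (-c) (by simp [hc])]
  · rw [if_pos]
    · rw [div_neg, div_self hc]; ring
  · intro n hn hne
    have hn0 : n ≠ 0 := by simpa using hn
    rw [if_neg, Nat.cast_zero]
    intro h
    have h' := (mul_eq_zero.mp h).resolve_left h2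
    field_simp at h'
    exact hne (by linear_combination h')

end Kloosterman

section QuadraticExtension

open QuadraticAlgebra

theorem exists_quadratic_extension_kloostermanSum.{u} {F : Type u} [Field F] [Fintype F]
    [DecidableEq F] {p : ℕ} [Fact p.Prime] [CharP F p] (hq : Odd (Fintype.card F))
    {ψ : AddChar F ℂ} (hψ : ψ ≠ 1) (hfrob : ∀ y, ψ (y ^ p) = ψ y) {c : F} (hc : c ≠ 0) :
    ∃ (E : Type u) (_ : Field E) (_ : Fintype E) (_ : DecidableEq E) (_ : CharP E p)
      (ψ' : AddChar E ℂ) (c' : E), Fintype.card E = Fintype.card F ^ 2 ∧ ψ' ≠ 1 ∧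
      (∀ y, ψ' (y ^ p) = ψ' y) ∧ c' ≠ 0 ∧
      kloostermanSum ψ' c' = 2 * Fintype.card F - kloostermanSum ψ c ^ 2 := by
  obtain ⟨δ, hδ⟩ := quadraticChar_exists_neg_one (ringChar_ne_two_of_odd_card hq)
  have h2 := two_ne_zero_of_odd_card hq
  have : Fact (∀ r : F, r ^ 2 ≠ δ + 0 * r) := ⟨fun r hr => by
    refine quadraticChar_neg_one_iff_not_isSquare.mp hδ ⟨r, ?_⟩
    rw [← sq, hr]; ring⟩
  let E := QuadraticAlgebra F δ 0
  let _ : Fintype E := Fintype.ofEquiv _ (equivProd δ 0).symm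
  let _ : DecidableEq E := Classical.decEq E
  have hchar : CharP E p := charP_of_injective_algebraMap (algebraMap F E).injective p
  let ψ' : AddChar E ℂ := ψ.compAddMonoidHom (trace : E →ₗ[F] F).toAddMonoidHom
  have hψ' : ∀ z : E, ψ' z = ψ (2 * z.re) := fun z => by
    change ψ (trace z) = _
    rw [trace_def, zero_mul, add_zero]
  refine ⟨E, inferInstance, inferInstance, inferInstance, hchar, ψ', algebraMap F E c, ?_, ?_, ?_,
    ?_, ?_⟩
  · rw [Fintype.card_congr (equivProd δ 0), Fintype.card_prod, sq]
  · obtain ⟨x, hx⟩ := AddChar.ne_one_iff.mp hψ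
    refine AddChar.ne_one_iff.mpr ⟨algebraMap F E (x / 2), ?_⟩
    rw [hψ', algebraMap_re, mul_div_cancel₀ _ h2]
    exact hx
  · intro z
    have htr : trace (z ^ p) = trace z ^ p := by
      apply (algebraMap F E).injective
      rw [RingHom.map_pow, algebraMap_trace_eq_add_star, algebraMap_trace_eq_add_star, add_pow_char,
        star_pow]
    change ψ (trace (z ^ p)) = ψ (trace z)
    rw [htr, hfrob]
  · simpa using hc
  · rw [eq_sub_iff_add_eq, add_comm, ← kloostermanSum_sq_add_sum_norm_form hq hψ hc hδ]
    congr 1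
    have hnorm : ∀ z : E, norm z = z.re ^ 2 - δ * z.im ^ 2 := fun z => by
      rw [norm_def]; ring
    refine Finset.sum_equiv (equivProd δ 0) (fun z => ?_) (fun z _ => ?_)
    · simp only [Finset.mem_filter, Finset.mem_univ, true_and]
      exact (not_congr ((hnorm z).symm ▸ norm_eq_zero_iff_eq_zero (z := z))).symm
    · rw [hψ']
      change ψ _ = ψ (2 * z.re * (1 + c / (z.re ^ 2 - δ * z.im ^ 2)))
      congr 1
      rw [← hnorm, re_add, QuadraticAlgebra.div_def, re_mul, QuadraticAlgebra.inv_def, algebraMap_re, algebraMap_im, re_smul,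
        re_star]
      simp only [smul_eq_mul]
      ring

end QuadraticExtension

section WeilBound

theorem norm_kloostermanSum_sq_le.{u} {p : ℕ} [Fact p.Prime] {B : ℝ} {F : Type u} [Field F]
    [Fintype F] [DecidableEq F] [CharP F p] (hq : Odd (Fintype.card F)) {ψ : AddChar F ℂ}
    (hψ : ψ ≠ 1) (hfrob : ∀ y, ψ (y ^ p) = ψ y) {c : F} (hc : c ≠ 0)
    (hB : ∀ (E : Type u) [Field E] [Fintype E] [DecidableEq E] [CharP E p] (ψ' : AddChar E ℂ)
      (c' : E), Fintype.card E = Fintype.card F ^ 2 → ψ' ≠ 1 → (∀ y, ψ' (y ^ p) = ψ' y) →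
      c' ≠ 0 → ‖kloostermanSum ψ' c'‖ ≤ B * Fintype.card F) :
    ‖kloostermanSum ψ c‖ ^ 2 ≤ (2 + B) * Fintype.card F := by
  obtain ⟨E, _, _, _, _, ψ', c', hcard, hψ', hfrob', hc', hK⟩ :=
    exists_quadratic_extension_kloostermanSum (p := p) hq hψ hfrob hc
  have h := hB E ψ' c' hcard hψ' hfrob' hc'
  have hsq : kloostermanSum ψ c ^ 2 = 2 * Fintype.card F - kloostermanSum ψ' c' := by
    rw [hK]; ring
  calc ‖kloostermanSum ψ c‖ ^ 2 = ‖(2 * Fintype.card F : ℂ) - kloostermanSum ψ' c'‖ := by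
        rw [← norm_pow, hsq]
    _ ≤ ‖(2 * Fintype.card F : ℂ)‖ + ‖kloostermanSum ψ' c'‖ := norm_sub_le _ _
    _ ≤ 2 * Fintype.card F + B * Fintype.card F := by
        gcongr
        simp
    _ = _ := by ring

theorem le_mul_sqrt_of_sq_le {x B N : ℝ} (hB : 0 ≤ B) (hN : 0 ≤ N) (h : x ^ 2 ≤ B ^ 2 * N) :
    x ≤ B * √N := by
  refine (le_abs_self x).trans (abs_le_of_sq_le_sq ?_ (by positivity))
  rwa [mul_pow, Real.sq_sqrt hN]

theorem norm_kloostermanSum_le_add_div_two_pow.{u} {p : ℕ} [Fact p.Prime] (k : ℕ) (F : Type u)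
    [Field F] [Fintype F] [DecidableEq F] [CharP F p] (hq : Odd (Fintype.card F))
    (ψ : AddChar F ℂ) (hψ : ψ ≠ 1) (hfrob : ∀ y, ψ (y ^ p) = ψ y) (c : F) (hc : c ≠ 0) :
    ‖kloostermanSum ψ c‖ ≤ (2 + 12 * p / 2 ^ k) * √(Fintype.card F) := by
  induction k generalizing F with
  | zero =>
    obtain ⟨m, -, hm⟩ := FiniteField.card F p
    refine le_mul_sqrt_of_sq_le (by positivity) (by positivity) ?_
    have h := norm_kloostermanSum_sq_le (p := p) (B := 12 * p) hq hψ hfrob hc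
      fun E _ _ _ _ ψ' c' hcard hψ' hfrob' hc' => by
        rw [hm] at hcard ⊢
        have hodd : Odd (Fintype.card E) := by
          rw [hcard, ← hm]; exact hq.pow
        exact_mod_cast norm_kloostermanSum_le_of_card_eq_sq hcard hodd hψ' hfrob' hc'
    refine h.trans ?_
    gcongr
    have : (0 : ℝ) ≤ p := by positivity
    nlinarith
  | succ k ih =>
    refine le_mul_sqrt_of_sq_le (by positivity) (by positivity) ?_
    have h := norm_kloostermanSum_sq_le (p := p) (B := 2 + 12 * p / 2 ^ k) hq hψ hfrob hc
      fun E _ _ _ _ ψ' c' hcard hψ' hfrob' hc' => by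
        have hodd : Odd (Fintype.card E) := by
          rw [hcard]; exact hq.pow
        refine (ih E hodd ψ' hψ' hfrob' c' hc').trans_eq ?_
        rw [hcard, Nat.cast_pow, Real.sqrt_sq (by positivity)]
    refine h.trans ?_
    gcongr
    have : (0 : ℝ) ≤ 12 * p / 2 ^ k := by positivity
    have hhalf : (12 * p / 2 ^ (k + 1) : ℝ) = 12 * p / 2 ^ k / 2 := by rw [pow_succ, div_div]
    rw [hhalf]
    nlinarith

/-- Weil's bound for Kloosterman sums. -/
theorem norm_kloostermanSum_le {p : ℕ} [Fact p.Prime] {F : Type*}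
    [Field F] [Fintype F] [DecidableEq F] [CharP F p] (hq : Odd (Fintype.card F))
    {ψ : AddChar F ℂ} (hψ : ψ ≠ 1) (hfrob : ∀ y, ψ (y ^ p) = ψ y) {c : F} (hc : c ≠ 0) :
    ‖kloostermanSum ψ c‖ ≤ 2 * √(Fintype.card F) := by
  have hlim : Filter.Tendsto (fun k : ℕ => (2 + 12 * p / 2 ^ k : ℝ) * √(Fintype.card F))
      Filter.atTop (nhds ((2 + 0) * √(Fintype.card F))) := by
    refine (tendsto_const_nhds.add ?_).mul_const _
    exact tendsto_const_nhds.div_atTop (tendsto_pow_atTop_atTop_of_one_lt one_lt_two)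
  rw [add_zero] at hlim
  exact ge_of_tendsto' hlim fun k =>
    norm_kloostermanSum_le_add_div_two_pow k F hq ψ hψ hfrob c hc

theorem exists_frobenius_invariant_addChar (F : Type*) [Field F] [Fintype F] {p : ℕ}
    [Fact p.Prime] [CharP F p] : ∃ ψ : AddChar F ℂ, ψ ≠ 1 ∧ ∀ y, ψ (y ^ p) = ψ y := by
  let _ : Algebra (ZMod p) F := ZMod.algebra F p
  refine ⟨ZMod.stdAddChar.compAddMonoidHom (Algebra.trace (ZMod p) F).toAddMonoidHom, ?_, ?_⟩
  · obtain ⟨x, hx⟩ := Algebra.trace_surjective (ZMod p) F 1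
    refine AddChar.ne_one_iff.mpr ⟨x, ?_⟩
    change ZMod.stdAddChar (Algebra.trace (ZMod p) F x) ≠ 1
    rw [hx]
    exact (AddChar.zmod_char_ne_one_iff p _).mp
      (by simpa using (ZMod.isPrimitive_stdAddChar p) one_ne_zero)
  · intro y
    change ZMod.stdAddChar (Algebra.trace (ZMod p) F (y ^ p))
      = ZMod.stdAddChar (Algebra.trace (ZMod p) F y)
    congr 1
    have h := Algebra.trace_eq_of_algEquiv 
      (FiniteField.frobeniusAlgEquivOfAlgebraic (ZMod p) F) y
    rwa [FiniteField.coe_frobeniusAlgEquivOfAlgebraic, ZMod.card] at h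

end WeilBound

section QuadraticGaussSum

variable {F : Type*} [Field F] [Fintype F] [DecidableEq F]

/-- The quadratic Gauss sum `∑ χ(t) ψ(t)`. -/
noncomputable def quadraticGaussSum (ψ : AddChar F ℂ) : ℂ :=
  ∑ t : F, (quadraticChar F t : ℂ) * ψ t

theorem norm_quadraticGaussSum (hq : Odd (Fintype.card F)) {ψ : AddChar F ℂ} (hψ : ψ ≠ 1) :
    ‖quadraticGaussSum ψ‖ = √(Fintype.card F) := by
  have hF := ringChar_ne_two_of_odd_card hq
  set χ : MulChar F ℂ := (quadraticChar F).ringHomComp (Int.castRingHom ℂ) with hχ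
  have hχ1 : χ ≠ 1 := (MulChar.ringHomComp_ne_one_iff
    (RingHom.injective_int (Int.castRingHom ℂ))).mpr (quadraticChar_ne_one hF)
  have hsq := gaussSum_sq hχ1 ((quadraticChar_isQuadratic F).comp _)
    (AddChar.IsPrimitive.of_ne_one hψ)
  have hG : gaussSum χ ψ = quadraticGaussSum ψ := rfl
  rw [hG] at hsq
  have hnorm : ‖χ (-1)‖ = 1 := by
    rcases quadraticChar_dichotomy (neg_ne_zero.mpr (one_ne_zero (α := F))) with h | h <;>
      simp [hχ, MulChar.ringHomComp_apply, h, -quadraticChar_apply]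
  have := congrArg norm hsq
  rw [norm_pow, norm_mul, hnorm, one_mul, Complex.norm_natCast] at this
  rw [← this, Real.sqrt_sq (norm_nonneg _)]

theorem sum_quadraticChar_mulShift (ψ : AddChar F ℂ) {s : F} (hs : s ≠ 0) :
    ∑ t : F, (quadraticChar F t : ℂ) * ψ (s * t) = quadraticChar F s * quadraticGaussSum ψ := by
  rw [quadraticGaussSum, ← Equiv.sum_comp (Equiv.mulLeft₀ s hs)
    (fun t => (quadraticChar F t : ℂ) * ψ t), Finset.mul_sum]
  refine Finset.sum_congr rfl fun t _ => ?_
  have h : ((quadraticChar F s : ℤ) : ℂ) ^ 2 = 1 := by exact_mod_cast quadraticChar_sq_one hs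
  simp only [Equiv.mulLeft₀_apply, map_mul, Int.cast_mul]
  linear_combination -((quadraticChar F t : ℤ) : ℂ) * ψ (s * t) * h

theorem sum_addChar_quadratic (hq : Odd (Fintype.card F)) {ψ : AddChar F ℂ} (hψ : ψ ≠ 1)
    {s : F} (hs : s ≠ 0) (m : F) :
    ∑ z : F, ψ (s * z ^ 2 + m * z)
      = quadraticChar F s * quadraticGaussSum ψ * ψ (-(m ^ 2 / 4) / s) := by
  have h2 := two_ne_zero_of_odd_card hq
  have h4 : (4 : F) ≠ 0 := by
    rw [show (4 : F) = 2 * 2 by norm_num]; exact mul_ne_zero h2 h2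
  have hsum : ∑ z : F, ψ (s * z ^ 2) = quadraticChar F s * quadraticGaussSum ψ := by
    rw [← sum_quadraticChar_mulShift ψ hs, ← Finset.sum_fiberwise _ (fun z => z ^ 2)]
    have : ∀ t : F, ∑ z : F with z ^ 2 = t, ψ (s * z ^ 2)
        = (quadraticChar F t : ℂ) * ψ (s * t) + ψ (t * s) := fun t => by
      rw [Finset.sum_congr rfl fun x hx => by rw [(Finset.mem_filter.mp hx).2],
        Finset.sum_const, nsmul_eq_mul, mul_comm t s, ← add_one_mul]
      congr 1
      exact_mod_cast card_sq_eq hq t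
    simp only [this, Finset.sum_add_distrib,
      AddChar.sum_mulShift _ (AddChar.IsPrimitive.of_ne_one hψ), if_neg hs, Nat.cast_zero, add_zero]
  rw [← hsum, Finset.sum_mul, ← Equiv.sum_comp (Equiv.subRight (m / (2 * s)))]
  refine Finset.sum_congr rfl fun z _ => ?_
  rw [← AddChar.map_add_eq_mul]
  congr 1
  simp only [Equiv.subRight_apply]
  field_simp
  ring

theorem sum_quadraticChar_add_inv (hq : Odd (Fintype.card F)) (ψ : AddChar F ℂ) :
    ∑ s : F with s ≠ 0, (quadraticChar F s : ℂ) * ψ (s + 1 / s)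
      = quadraticGaussSum ψ * (ψ (-2) + ψ 2) := by
  have h2 := two_ne_zero_of_odd_card hq
  have hsplit : ∀ s : F, s ≠ 0 → (quadraticChar F s : ℂ) * ψ (s + 1 / s)
      = (quadraticChar F (s + 1 / s + 2) : ℂ) * ψ (s + 1 / s)
        + if s = -1 then (quadraticChar F (-1) : ℂ) * ψ (-2) else 0 := fun s hs => by
    split_ifs with h
    · subst h
      rw [show (-1 : F) + 1 / -1 = -2 by norm_num, neg_add_cancel, quadraticChar_zero]
      simp
    · have h' : s + 1 ≠ 0 := fun h0 => h (eq_neg_of_add_eq_zero_left h0)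
      rw [show s + 1 / s + 2 = (s + 1) ^ 2 / s by field_simp; ring, quadraticChar_div _ hs,
        quadraticChar_sq_one' h', mul_one, add_zero]
  have hsplit' : ∀ t : F,
      (quadraticChar F (t ^ 2 - 4 * 1) + 1 : ℂ) * (quadraticChar F (t + 2) * ψ t)
      = (quadraticChar F (t + 2) : ℂ) * ψ t + (quadraticChar F (t - 2) : ℂ) * ψ t
        - if t = -2 then (quadraticChar F (-1) : ℂ) * ψ (-2) else 0 := fun t => by
    rw [show t ^ 2 - 4 * 1 = (t - 2) * (t + 2) by ring, map_mul]
    split_ifs with h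
    · subst h
      rw [neg_add_cancel, quadraticChar_zero, show (-2 : F) - 2 = -1 * 2 ^ 2 by norm_num, map_mul,
        quadraticChar_sq_one' h2]
      simp
    · have h' : t + 2 ≠ 0 := fun h0 => h (eq_neg_of_add_eq_zero_left h0)
      have hsq : ((quadraticChar F (t + 2) : ℤ) : ℂ) ^ 2 = 1 := by
        exact_mod_cast quadraticChar_sq_one h'
      push_cast
      linear_combination (quadraticChar F (t - 2) : ℂ) * ψ t * hsq
  have hshift : ∀ a : F, ∑ t : F, (quadraticChar F (t + a) : ℂ) * ψ t
      = quadraticGaussSum ψ * ψ (-a) := fun a => by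
    rw [quadraticGaussSum, ← Equiv.sum_comp (Equiv.addRight a) (fun t => (quadraticChar F t : ℂ) * ψ t), Finset.sum_mul]
    refine Finset.sum_congr rfl fun t _ => ?_
    rw [Equiv.coe_addRight, mul_assoc, ← AddChar.map_add_eq_mul, add_neg_cancel_right]
  rw [Finset.sum_congr rfl fun s hs => hsplit s (Finset.mem_filter.mp hs).2,
    Finset.sum_add_distrib,
    sum_add_div_eq hq one_ne_zero (fun t => (quadraticChar F (t + 2) : ℂ) * ψ t),
    Finset.sum_congr rfl fun t _ => hsplit' t, Finset.sum_sub_distrib, Finset.sum_add_distrib,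
    Finset.sum_ite_eq' _ (-2 : F), Finset.sum_ite_eq' _ (-1 : F), hshift]
  simp only [sub_eq_add_neg _ (2 : F), hshift, neg_neg]
  simp
  ring

/-- The bound for Salié sums. -/
theorem norm_sum_quadraticChar_add_div_le (hq : Odd (Fintype.card F)) {ψ : AddChar F ℂ}
    (hψ : ψ ≠ 1) {c : F} (hc : c ≠ 0) :
    ‖∑ s : F with s ≠ 0, (quadraticChar F s : ℂ) * ψ (s + c / s)‖ ≤ 2 * √(Fintype.card F) := by
  by_cases hsq : IsSquare c
  · obtain ⟨e, rfl⟩ := hsq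
    have he : e ≠ 0 := left_ne_zero_of_mul hc
    have hscale : ∑ s : F with s ≠ 0, (quadraticChar F s : ℂ) * ψ (s + e * e / s)
        = quadraticChar F e * ∑ s : F with s ≠ 0,
          (quadraticChar F s : ℂ) * ψ.mulShift e (s + 1 / s) := by
      rw [Finset.mul_sum]
      refine (Finset.sum_equiv (Equiv.mulLeft₀ e he) (by simp [he]) fun s hs => ?_).symm
      have hs : s ≠ 0 := (Finset.mem_filter.mp hs).2
      rw [AddChar.mulShift_apply, Equiv.mulLeft₀_apply, map_mul (quadraticChar F), Int.cast_mul, mul_assoc]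
      congr 3
      field_simp
    have hprim : ψ.mulShift e ≠ 1 := AddChar.IsPrimitive.of_ne_one hψ he
    rw [hscale, sum_quadraticChar_add_inv hq, norm_mul, norm_mul, norm_quadraticGaussSum hq hprim]
    calc ‖(quadraticChar F e : ℂ)‖ * (√(Fintype.card F) * ‖ψ.mulShift e (-2) + ψ.mulShift e 2‖)
        ≤ 1 * (√(Fintype.card F) * (1 + 1)) := by
          gcongr
          · exact norm_quadraticChar_le_one e
          · refine (norm_add_le _ _).trans ?_
            rw [AddChar.norm_apply, AddChar.norm_apply]
      _ = _ := by ring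
  · have hχ : quadraticChar F c = -1 := quadraticChar_neg_one_iff_not_isSquare.mpr hsq
    have hflip : ∑ s : F with s ≠ 0, (quadraticChar F s : ℂ) * ψ (s + c / s)
        = -∑ s : F with s ≠ 0, (quadraticChar F s : ℂ) * ψ (s + c / s) := by
      rw [← Finset.sum_neg_distrib]
      refine Finset.sum_bij' (fun s _ => c / s) (fun s _ => c / s) ?_ ?_ ?_ ?_ ?_
      · intro s hs; simpa [hc] using hs
      · intro s hs; simpa [hc] using hs
      · intro s _; exact div_div_cancel₀ hc
      · intro s _; exact div_div_cancel₀ hc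
      · intro s hs
        have hs : s ≠ 0 := (Finset.mem_filter.mp hs).2
        rw [quadraticChar_div _ hs, hχ, div_div_cancel₀ hc, add_comm s]
        push_cast
        ring
    rw [self_eq_neg.mp hflip, norm_zero]
    positivity

theorem norm_sum_quadraticChar_pow_mul_le {p : ℕ} [Fact p.Prime] [CharP F p]
    (hq : Odd (Fintype.card F)) {ψ : AddChar F ℂ} (hψ : ψ ≠ 1) (hfrob : ∀ y, ψ (y ^ p) = ψ y)
    (d : ℕ) {a : F} (ha : a ≠ 0) (b : F) :
    ‖∑ s : F with s ≠ 0, (quadraticChar F s : ℂ) ^ d * ψ (a * s + b / s)‖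
      ≤ 2 * √(Fintype.card F) := by
  have hone : 1 ≤ √(Fintype.card F : ℝ) :=
    Real.one_le_sqrt.mpr (by exact_mod_cast Fintype.card_pos)
  have hscale : ∑ s : F with s ≠ 0, (quadraticChar F s : ℂ) ^ d * ψ (a * s + b / s)
      = (quadraticChar F a : ℂ) ^ d *
        ∑ s : F with s ≠ 0, (quadraticChar F s : ℂ) ^ d * ψ (s + a * b / s) := by
    rw [Finset.mul_sum]
    refine Finset.sum_equiv (Equiv.mulLeft₀ a ha) (by simp [ha]) fun s hs => ?_
    have hs : s ≠ 0 := (Finset.mem_filter.mp hs).2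
    have hsq : ((quadraticChar F a : ℤ) : ℂ) ^ 2 = 1 := by exact_mod_cast quadraticChar_sq_one ha
    rw [Equiv.mulLeft₀_apply, map_mul, Int.cast_mul, ← mul_assoc, ← mul_pow, ← mul_assoc, ← sq, hsq,
      one_mul]
    congr 2
    field_simp
  rw [hscale, norm_mul]
  refine (mul_le_of_le_one_left (norm_nonneg _) (by
    rw [norm_pow]; exact pow_le_one₀ (norm_nonneg _) (norm_quadraticChar_le_one a))).trans ?_
  rcases Nat.even_or_odd' d with ⟨k, rfl | rfl⟩
  · have hpow : ∀ s : F, s ≠ 0 → ((quadraticChar F s : ℤ) : ℂ) ^ (2 * k) = 1 := fun s hs => by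
      rw [pow_mul]
      exact_mod_cast by rw [quadraticChar_sq_one hs, one_pow]
    rw [Finset.sum_congr rfl fun s hs => by rw [hpow s (Finset.mem_filter.mp hs).2, one_mul]]
    rcases eq_or_ne b 0 with rfl | hb
    · have h := AddChar.sum_eq_zero_of_ne_one hψ
      rw [← Finset.add_sum_erase _ _ (Finset.mem_univ (0 : F)), AddChar.map_zero_eq_one] at h
      simp only [mul_zero, zero_div, add_zero, Finset.filter_ne']
      rw [eq_neg_of_add_eq_zero_right h, norm_neg, norm_one]
      linarith
    · exact norm_kloostermanSum_le hq hψ hfrob (mul_ne_zero ha hb)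
  · have hpow : ∀ s : F, ((quadraticChar F s : ℤ) : ℂ) ^ (2 * k + 1) = quadraticChar F s :=
      fun s => by
        rcases quadraticChar_isQuadratic F s with h | h | h <;> simp [h, pow_succ, pow_mul]
    simp only [hpow]
    rcases eq_or_ne b 0 with rfl | hb
    · simp only [mul_zero, zero_div, add_zero, Finset.filter_ne']
      rw [Finset.sum_erase _ (by simp)]
      have := norm_quadraticGaussSum hq hψ
      rw [quadraticGaussSum] at this
      rw [this]
      linarith
    · exact norm_sum_quadraticChar_add_div_le hq hψ (mul_ne_zero ha hb)

end QuadraticGaussSum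

section Fourier

theorem AddChar.map_sum_eq_prod {ι A M : Type*} [AddCommMonoid A] [CommMonoid M]
    (ψ : AddChar A M) (s : Finset ι) (f : ι → A) :
    ψ (∑ i ∈ s, f i) = ∏ i ∈ s, ψ (f i) := by
  classical
  induction s using Finset.induction_on with
  | empty => simp
  | insert a s ha ih => rw [Finset.sum_insert ha, Finset.prod_insert ha, AddChar.map_add_eq_mul, ih]

variable {F : Type*} [Field F] [Fintype F] [DecidableEq F] {d : ℕ}

theorem sum_addChar_dotProduct {ψ : AddChar F ℂ} (hψ : ψ ≠ 1) (z : Fin d → F) :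
    ∑ m : Fin d → F, ψ (m ⬝ᵥ z) = if z = 0 then (Fintype.card F : ℂ) ^ d else 0 := by
  have hprod : ∑ m : Fin d → F, ψ (m ⬝ᵥ z) = ∏ i, ∑ t : F, ψ (t * z i) := by
    rw [Finset.prod_univ_sum, Fintype.piFinset_univ]
    exact Finset.sum_congr rfl fun m _ => AddChar.map_sum_eq_prod ψ _ _
  simp only [hprod, AddChar.sum_mulShift _ (AddChar.IsPrimitive.of_ne_one hψ)]
  split_ifs with h
  · simp [h]
  · obtain ⟨i, hi⟩ := Function.ne_iff.mp h
    exact Finset.prod_eq_zero (Finset.mem_univ i) (by simpa using hi)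

theorem sum_norm_sq_sum_addChar {ψ : AddChar F ℂ} (hψ : ψ ≠ 1) (P : Finset (Fin d → F)) :
    ∑ m : Fin d → F, ‖∑ x ∈ P, ψ (m ⬝ᵥ x)‖ ^ 2 = (Fintype.card F : ℝ) ^ d * #P := by
  have h : ∑ m : Fin d → F, (‖∑ x ∈ P, ψ (m ⬝ᵥ x)‖ ^ 2 : ℂ) = (Fintype.card F : ℂ) ^ d * #P := by
    have hexp : ∀ m : Fin d → F, (‖∑ x ∈ P, ψ (m ⬝ᵥ x)‖ ^ 2 : ℂ)
        = ∑ x ∈ P, ∑ y ∈ P, ψ (m ⬝ᵥ (x - y)) := fun m => by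
      rw [← Complex.mul_conj', map_sum, Finset.sum_mul_sum]
      simp_rw [dotProduct_sub, sub_eq_add_neg, AddChar.map_add_eq_mul, AddChar.map_neg_eq_conj]
    rw [Finset.sum_congr rfl fun m _ => hexp m, Finset.sum_comm,
      Finset.sum_congr rfl fun x _ => Finset.sum_comm]
    simp only [sum_addChar_dotProduct hψ, sub_eq_zero, Finset.sum_ite_eq]
    rw [Finset.sum_congr rfl fun x hx => if_pos hx, Finset.sum_const, nsmul_eq_mul, mul_comm]
  exact_mod_cast h

/-- A convolution kernel whose Fourier transform is bounded by `Λ` acts with norm at most `Λ`. -/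
theorem norm_sum_sum_sub_le {ψ : AddChar F ℂ} (hψ : ψ ≠ 1) (k : (Fin d → F) → ℂ) {Λ : ℝ}
    (hk : ∀ m : Fin d → F, ‖∑ z, k z * ψ (m ⬝ᵥ z)‖ ≤ Λ) (P S : Finset (Fin d → F)) :
    ‖∑ x ∈ P, ∑ y ∈ S, k (x - y)‖ ≤ Λ * √(#P * #S) := by
  have hΛ : 0 ≤ Λ := (norm_nonneg _).trans (hk 0)
  have hN : (0 : ℝ) < (Fintype.card F : ℝ) ^ d := by
    have : 0 < Fintype.card F := Fintype.card_pos
    positivity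
  have hinv : ∀ w, (Fintype.card F : ℂ) ^ d * k w
      = ∑ m : Fin d → F, (∑ z, k z * ψ (m ⬝ᵥ z)) * ψ (-(m ⬝ᵥ w)) := fun w => by
    simp only [Finset.sum_mul, mul_assoc, ← AddChar.map_add_eq_mul, ← sub_eq_add_neg,
      ← dotProduct_sub]
    rw [Finset.sum_comm]
    simp only [← Finset.mul_sum, sum_addChar_dotProduct hψ, sub_eq_zero, mul_ite, mul_zero]
    rw [Finset.sum_ite_eq' _ w, if_pos (Finset.mem_univ w), mul_comm]
  have hexp : (Fintype.card F : ℂ) ^ d * ∑ x ∈ P, ∑ y ∈ S, k (x - y)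
      = ∑ m : Fin d → F, (∑ z, k z * ψ (m ⬝ᵥ z)) *
        ((starRingEnd ℂ) (∑ x ∈ P, ψ (m ⬝ᵥ x)) * ∑ y ∈ S, ψ (m ⬝ᵥ y)) := by
    simp only [Finset.mul_sum P, Finset.mul_sum S, hinv]
    rw [Finset.sum_congr rfl fun x _ => Finset.sum_comm, Finset.sum_comm]
    refine Finset.sum_congr rfl fun m _ => ?_
    rw [Finset.sum_comm]
    refine Finset.sum_congr rfl fun y _ => ?_
    rw [map_sum, Finset.sum_mul P, Finset.mul_sum P]
    refine Finset.sum_congr rfl fun x _ => ?_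
    rw [← AddChar.map_neg_eq_conj, ← AddChar.map_add_eq_mul, dotProduct_sub, neg_sub,
      sub_eq_neg_add]
  have hcs : ∑ m : Fin d → F, ‖∑ x ∈ P, ψ (m ⬝ᵥ x)‖ * ‖∑ y ∈ S, ψ (m ⬝ᵥ y)‖
      ≤ (Fintype.card F : ℝ) ^ d * √(#P * #S) := by
    refine (Real.sum_mul_le_sqrt_mul_sqrt _ _ _).trans_eq ?_
    rw [sum_norm_sq_sum_addChar hψ, sum_norm_sq_sum_addChar hψ, ← Real.sqrt_mul (by positivity),
      mul_mul_mul_comm, Real.sqrt_mul (by positivity), Real.sqrt_mul_self hN.le]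
  refine le_of_mul_le_mul_left ?_ hN
  calc (Fintype.card F : ℝ) ^ d * ‖∑ x ∈ P, ∑ y ∈ S, k (x - y)‖
      = ‖(Fintype.card F : ℂ) ^ d * ∑ x ∈ P, ∑ y ∈ S, k (x - y)‖ := by simp
    _ ≤ ∑ m : Fin d → F, Λ * (‖∑ x ∈ P, ψ (m ⬝ᵥ x)‖ * ‖∑ y ∈ S, ψ (m ⬝ᵥ y)‖) := by
        rw [hexp]
        refine norm_sum_le_of_le _ fun m _ => ?_
        rw [norm_mul, norm_mul, RCLike.norm_conj]
        exact mul_le_mul_of_nonneg_right (hk m) (by positivity)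
    _ ≤ Λ * ((Fintype.card F : ℝ) ^ d * √(#P * #S)) := by
        rw [← Finset.mul_sum]
        exact mul_le_mul_of_nonneg_left hcs hΛ
    _ = _ := by ring

theorem sum_addChar_normForm (hq : Odd (Fintype.card F)) {ψ : AddChar F ℂ} (hψ : ψ ≠ 1)
    {s : F} (hs : s ≠ 0) (m : Fin d → F) :
    ∑ z : Fin d → F, ψ (s * normForm z + m ⬝ᵥ z)
      = (quadraticChar F s * quadraticGaussSum ψ) ^ d * ψ (-(normForm m / 4) / s) := by
  have hprod : ∑ z : Fin d → F, ψ (s * normForm z + m ⬝ᵥ z)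
      = ∏ i, ∑ t : F, ψ (s * t ^ 2 + m i * t) := by
    rw [Finset.prod_univ_sum, Fintype.piFinset_univ]
    refine Finset.sum_congr rfl fun z _ => ?_
    rw [← AddChar.map_sum_eq_prod, normForm, dotProduct, Finset.mul_sum, Finset.sum_add_distrib]
  simp only [hprod, sum_addChar_quadratic hq hψ hs]
  rw [Finset.prod_mul_distrib, Finset.prod_const, Finset.card_univ, Fintype.card_fin,
    ← AddChar.map_sum_eq_prod, ← Finset.sum_div, Finset.sum_neg_distrib, ← Finset.sum_div, normForm]

/-- The indicator of the sphere of radius `r`, minus its expected density `q⁻¹`. -/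
noncomputable def sphereDeviation (r : F) (z : Fin d → F) : ℂ :=
  (if normForm z = r then 1 else 0) - (Fintype.card F : ℂ)⁻¹

theorem card_mul_sphereDeviation {ψ : AddChar F ℂ} (hψ : ψ ≠ 1) (r : F) (z : Fin d → F) :
    (Fintype.card F : ℂ) * sphereDeviation r z
      = ∑ s : F with s ≠ 0, ψ (s * (normForm z - r)) := by
  have h0 : (Fintype.card F : ℂ) ≠ 0 := by exact_mod_cast Fintype.card_ne_zero
  have h := AddChar.sum_mulShift (normForm z - r) (AddChar.IsPrimitive.of_ne_one hψ)
  rw [← Finset.add_sum_erase _ _ (Finset.mem_univ (0 : F)), zero_mul, AddChar.map_zero_eq_one] at h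
  rw [Finset.filter_ne', eq_sub_of_add_eq' h, sphereDeviation, mul_sub, mul_inv_cancel₀ h0]
  simp [sub_eq_zero]

theorem norm_sum_sphereDeviation_le {p : ℕ} [Fact p.Prime] [CharP F p]
    (hq : Odd (Fintype.card F)) {ψ : AddChar F ℂ} (hψ : ψ ≠ 1) (hfrob : ∀ y, ψ (y ^ p) = ψ y)
    (hd : d ≠ 0) {r : F} (hr : r ≠ 0) (m : Fin d → F) :
    ‖∑ z, sphereDeviation r z * ψ (m ⬝ᵥ z)‖ ≤ 2 * √((Fintype.card F : ℝ) ^ (d - 1)) := by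
  have hq0 : (0 : ℝ) < Fintype.card F := by exact_mod_cast Fintype.card_pos
  have hexp : (Fintype.card F : ℂ) * ∑ z, sphereDeviation r z * ψ (m ⬝ᵥ z)
      = quadraticGaussSum ψ ^ d * ∑ s : F with s ≠ 0,
        (quadraticChar F s : ℂ) ^ d * ψ (-r * s + -(normForm m / 4) / s) := by
    simp only [Finset.mul_sum, ← mul_assoc, card_mul_sphereDeviation hψ, Finset.sum_mul]
    rw [Finset.sum_comm]
    refine Finset.sum_congr rfl fun s hs => ?_
    have h := sum_addChar_normForm hq hψ (Finset.mem_filter.mp hs).2 m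
    calc ∑ z, ψ (s * (normForm z - r)) * ψ (m ⬝ᵥ z)
        = ψ (-r * s) * ∑ z, ψ (s * normForm z + m ⬝ᵥ z) := by
          rw [Finset.mul_sum]
          refine Finset.sum_congr rfl fun z _ => ?_
          rw [← AddChar.map_add_eq_mul, ← AddChar.map_add_eq_mul]
          congr 1
          ring
      _ = _ := by
          rw [h, AddChar.map_add_eq_mul]
          ring
  refine le_of_mul_le_mul_left ?_ hq0
  calc (Fintype.card F : ℝ) * ‖∑ z, sphereDeviation r z * ψ (m ⬝ᵥ z)‖
      = ‖(Fintype.card F : ℂ) * ∑ z, sphereDeviation r z * ψ (m ⬝ᵥ z)‖ := by simp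
    _ ≤ √(Fintype.card F) ^ d * (2 * √(Fintype.card F)) := by
        rw [hexp, norm_mul, norm_pow, norm_quadraticGaussSum hq hψ]
        gcongr
        exact norm_sum_quadraticChar_pow_mul_le hq hψ hfrob d (neg_ne_zero.mpr hr) _
    _ = Fintype.card F * (2 * √((Fintype.card F : ℝ) ^ (d - 1))) := by
        obtain ⟨e, rfl⟩ := Nat.exists_eq_succ_of_ne_zero hd
        have hsqrt : √((Fintype.card F : ℝ) ^ e) = √(Fintype.card F) ^ e := by
          rw [Real.sqrt_eq_iff_eq_sq (by positivity) (by positivity), ← pow_mul, mul_comm, pow_mul,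
            Real.sq_sqrt hq0.le]
        rw [Nat.succ_sub_one, hsqrt, pow_succ]
        linear_combination 2 * √(Fintype.card F : ℝ) ^ e * Real.mul_self_sqrt hq0.le

theorem sphIncid_sub_eq_sum_sphereDeviation (r : F) (P : Finset (Fin d → F))
    (S : Finset ((Fin d → F) × F)) (hS : ∀ s ∈ S, s.2 = r) :
    (sphIncid normForm P S : ℂ) - (Fintype.card F : ℂ)⁻¹ * #P * #S
      = ∑ x ∈ P, ∑ y ∈ S.image Prod.fst, sphereDeviation r (x - y) := by
  have hinj : Set.InjOn Prod.fst (S : Set ((Fin d → F) × F)) := fun s hs t ht h =>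
    Prod.ext h ((hS s hs).trans (hS t ht).symm)
  have hI : (sphIncid normForm P S : ℂ)
      = ∑ x ∈ P, ∑ s ∈ S, if normForm (x - s.1) = r then 1 else 0 := by
    rw [sphIncid, Finset.card_filter, Finset.sum_product]
    push_cast
    exact Finset.sum_congr rfl fun x _ => Finset.sum_congr rfl fun s hs => by rw [hS s hs]
  simp only [Finset.sum_image hinj, sphereDeviation, Finset.sum_sub_distrib, Finset.sum_const,
    nsmul_eq_mul, hI]
  ring

end Fourier

/-- Iosevich–Rudnev point–sphere incidence bound for spheres of a common
non-zero radius. -/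
theorem stmt0 {F : Type*} [Field F] [Fintype F] [DecidableEq F]
    (hq : Odd (Fintype.card F)) {d : ℕ} (hd : 2 ≤ d)
    (r : F) (hr : r ≠ 0)
    (P : Finset (Fin d → F)) (S : Finset ((Fin d → F) × F))
    (hS : ∀ s ∈ S, s.2 = r) :
    |(sphIncid normForm P S : ℝ) - (Fintype.card F : ℝ)⁻¹ * P.card * S.card|
      ≤ 2 * Real.sqrt ((Fintype.card F : ℝ) ^ (d-1) * P.card * S.card) := by
  obtain ⟨p, hp⟩ := CharP.exists F
  have : Fact p.Prime := ⟨CharP.char_is_prime F p⟩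
  obtain ⟨ψ, hψ, hfrob⟩ := exists_frobenius_invariant_addChar F (p := p)
  have hcard : #(S.image Prod.fst) = #S := Finset.card_image_of_injOn fun s hs t ht h =>
    Prod.ext h ((hS s hs).trans (hS t ht).symm)
  have h := norm_sum_sum_sub_le hψ (sphereDeviation r)
    (norm_sum_sphereDeviation_le hq hψ hfrob (by omega) hr) P (S.image Prod.fst)
  rw [← sphIncid_sub_eq_sum_sphereDeviation r P S hS, hcard, mul_assoc 2,
    ← Real.sqrt_mul (by positivity), ← mul_assoc _ (#P : ℝ)] at h
  rw [← Real.norm_eq_abs, ← Complex.norm_real]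
  push_cast
  exact h
end

section
/- Fix an even integer d ≥ 4 and i ∈ {1,2}. For every ε > 0 there exists q₀ such that for every odd prime power q ≥ q₀ the following holds: for every set P of points in F_q^d and every set S of Q_i^d-spheres all of whose radii are non-zero, |I(P,S) − q^{−1}|P||S|| ≤ (1+ε)·√(|P|·(q^{d−1}|S| + q^{d/2−1}|S|²)). -/
open Finset

section CenteredIndicator

variable {F : Type*} [Field F] [Fintype F] [DecidableEq F]

/-- The function `q·1_{t = 0} − 1` on a field with `q` elements. -/
noncomputable def centeredIndicator (t : F) : ℝ :=
  (if t = 0 then (Fintype.card F : ℝ) else 0) - 1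

theorem sum_erase_addChar_mul {ψ : AddChar F ℂ} (hψ : ψ.IsPrimitive) (t : F) :
    ∑ m ∈ univ.erase (0 : F), ψ (m * t) = centeredIndicator t := by
  rw [Finset.sum_erase_eq_sub (mem_univ _), AddChar.sum_mulShift t hψ]
  simp only [centeredIndicator]
  split_ifs <;> simp

theorem centeredIndicator_mul_eq_sum {ψ : AddChar F ℂ} (hψ : ψ.IsPrimitive) (s t : F) :
    ((centeredIndicator s * centeredIndicator t : ℝ) : ℂ)
      = ∑ w ∈ univ.erase (0 : F), ∑ m ∈ univ.erase (0 : F), ψ (m * (s + w * t)) := by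
  push_cast
  rw [← sum_erase_addChar_mul hψ, ← sum_erase_addChar_mul hψ, Finset.sum_mul, Finset.sum_comm]
  refine Finset.sum_congr rfl fun m hm => ?_
  have hm0 : m ≠ 0 := Finset.ne_of_mem_erase hm
  rw [Finset.mul_sum]
  refine Finset.sum_nbij' (fun n => n / m) (fun w => m * w) ?_ ?_ ?_ ?_ ?_
  · intro n hn
    simpa [hm0] using hn
  · intro w hw
    simpa [hm0] using hw
  · intro n _
    field_simp
  · intro w _
    field_simp
  · intro n _
    rw [← AddChar.map_add_eq_mul]
    congr 1
    field_simp

theorem card_quadratic_roots_le_two {a : F} (ha : a ≠ 0) (b c : F) :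
    (univ.filter fun w : F => a * w ^ 2 + b * w + c = 0).card ≤ 2 := by
  classical
  set p : Polynomial F := Polynomial.C a * Polynomial.X ^ 2 + Polynomial.C b * Polynomial.X
    + Polynomial.C c with hp
  have hdeg : p.natDegree = 2 := Polynomial.natDegree_quadratic ha
  have hp0 : p ≠ 0 := by
    intro h
    simp [h] at hdeg
  calc _ ≤ p.roots.toFinset.card := by
        refine Finset.card_le_card fun w hw => ?_
        simp only [mem_filter, mem_univ, true_and] at hw
        rw [Multiset.mem_toFinset, Polynomial.mem_roots hp0]
        simp [hp, hw]
    _ ≤ p.roots.card := Multiset.toFinset_card_le _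
    _ ≤ 2 := hdeg ▸ p.card_roots'

/-- The sum that controls the correlation of two spheres of radii `r`, `r' ≠ 0`. -/
theorem abs_sum_centeredIndicator_le (r D : F) {r' : F} (hr' : r' ≠ 0) :
    |∑ w ∈ (univ.erase (0 : F)).erase (-1),
        centeredIndicator (w / (1 + w) * D - r - w * r')| ≤ Fintype.card F + 2 := by
  set A := (univ.erase (0 : F)).erase (-1) with hA
  have hroots : (A.filter fun w => w / (1 + w) * D - r - w * r' = 0).card ≤ 2 := by
    refine (Finset.card_le_card fun w hw => ?_).trans
      (card_quadratic_roots_le_two (neg_ne_zero.mpr hr') (D - r - r') (-r))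
    simp only [hA, mem_filter, mem_erase, mem_univ, true_and, and_true] at hw ⊢
    obtain ⟨⟨hw1, -⟩, h⟩ := hw
    have h1 : 1 + w ≠ 0 := fun h => hw1 (by linear_combination h)
    field_simp at h
    linear_combination h
  have hcardA : (A.card : ℝ) ≤ Fintype.card F := by
    exact_mod_cast Finset.card_le_univ A
  simp only [centeredIndicator]
  rw [Finset.sum_sub_distrib, ← Finset.sum_filter, Finset.sum_const, Finset.sum_const]
  set N := (A.filter fun w => w / (1 + w) * D - r - w * r' = 0).card
  have hcardA' : (Fintype.card F : ℝ) ≤ A.card + 2 := by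
    have h1 := Finset.pred_card_le_card_erase (s := (univ : Finset F)) (a := 0)
    have h2 := Finset.pred_card_le_card_erase (s := (univ : Finset F).erase 0) (a := -1)
    rw [Finset.card_univ] at h1
    rw [← hA] at h2
    have h3 : Fintype.card F ≤ A.card + 2 := by omega
    exact_mod_cast h3
  have hN : (N : ℝ) ≤ 2 := by exact_mod_cast hroots
  have hN0 : (0 : ℝ) ≤ N := N.cast_nonneg
  have hq : (0 : ℝ) ≤ Fintype.card F := Nat.cast_nonneg _
  simp only [nsmul_eq_mul, mul_one]
  rw [abs_le]
  constructor <;> nlinarith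

end CenteredIndicator

section SphereIncidences

variable {F V : Type*} [Field F] [AddCommGroup V] [Module F V]

theorem quadraticForm_map_add_smul (Q : QuadraticForm F V) (y v : V) (t : F) :
    Q (y + t • v) = Q y + t ^ 2 * Q v + t * QuadraticMap.polar Q y v := by
  rw [QuadraticMap.map_add Q, QuadraticMap.polar_smul_right, QuadraticMap.map_smul]
  simp only [smul_eq_mul]
  ring

variable [Fintype V]

theorem sum_addChar_polar_eq_zero {ψ : AddChar F ℂ} (hψ : ψ.IsPrimitive)
    (Q : QuadraticForm F V) {v w : V} (hvw : QuadraticMap.polar Q w v ≠ 0) {m : F} (hm : m ≠ 0) :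
    ∑ x, ψ (m * QuadraticMap.polar Q x v) = 0 := by
  let χ : AddChar V ℂ :=
    { toFun := fun x => ψ (m * QuadraticMap.polar Q x v)
      map_zero_eq_one' := by simp
      map_add_eq_mul' := fun x y => by
        rw [QuadraticMap.polar_add_left, mul_add, AddChar.map_add_eq_mul] }
  refine AddChar.sum_eq_zero_of_ne_one (ψ := χ) fun hχ => ?_
  refine hψ (mul_ne_zero hm hvw) ?_
  ext t
  have h : χ (t • w) = 1 := by rw [hχ, AddChar.one_apply]
  rw [AddChar.mulShift_apply, AddChar.one_apply, ← h]
  change _ = ψ (m * QuadraticMap.polar Q (t • w) v)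
  rw [QuadraticMap.polar_smul_left, smul_eq_mul]
  congr 1
  ring

theorem sum_addChar_pencil {ψ : AddChar F ℂ} (Q : QuadraticForm F V) {g : ℂ}
    (hG : ∀ k : F, k ≠ 0 → ∑ x, ψ (k * Q x) = g) (c c' : V) (r r' : F)
    {m w : F} (hm : m ≠ 0) (hw : 1 + w ≠ 0) :
    ∑ x, ψ (m * (Q (x - c) - r + w * (Q (x - c') - r')))
      = g * ψ (m * (w / (1 + w) * Q (c - c') - r - w * r')) := by
  rw [← hG _ (mul_ne_zero hm hw), Finset.sum_mul,
    ← Equiv.sum_comp (Equiv.addRight ((1 + w)⁻¹ • (c + w • c')))]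
  refine Finset.sum_congr rfl fun y _ => ?_
  have h1 : Equiv.addRight ((1 + w)⁻¹ • (c + w • c')) y - c = y + (-(w / (1 + w))) • (c - c') := by
    rw [Equiv.coe_addRight]
    match_scalars <;> field_simp
    ring
  have h2 : Equiv.addRight ((1 + w)⁻¹ • (c + w • c')) y - c' = y + (1 + w)⁻¹ • (c - c') := by
    rw [Equiv.coe_addRight]
    match_scalars <;> field_simp
    ring
  rw [h1, h2, quadraticForm_map_add_smul, quadraticForm_map_add_smul, ← AddChar.map_add_eq_mul]
  congr 1
  field_simp
  ring

theorem sum_addChar_sub {ψ : AddChar F ℂ} (hψ : ψ.IsPrimitive) (Q : QuadraticForm F V)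
    (hN : ∀ v : V, v ≠ 0 → ∃ w, QuadraticMap.polar Q w v ≠ 0) {c c' : V} (hc : c ≠ c')
    (r r' : F) {m : F} (hm : m ≠ 0) :
    ∑ x, ψ (m * (Q (x - c) - r + -1 * (Q (x - c') - r'))) = 0 := by
  obtain ⟨w, hw⟩ := hN (c - c') (sub_ne_zero.mpr hc)
  rw [← Equiv.sum_comp (Equiv.addRight c)]
  have h : ∀ y : V, ψ (m * (Q (Equiv.addRight c y - c) - r
        + -1 * (Q (Equiv.addRight c y - c') - r')))
      = ψ (-m * QuadraticMap.polar Q y (c - c')) * ψ (m * (r' - r - Q (c - c'))) := fun y => by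
    rw [← AddChar.map_add_eq_mul, Equiv.coe_addRight, add_sub_cancel_right, add_sub_assoc,
      QuadraticMap.map_add Q y]
    congr 1
    ring
  simp_rw [h]
  rw [← Finset.sum_mul, sum_addChar_polar_eq_zero hψ Q hw (neg_ne_zero.mpr hm), zero_mul]

variable [Fintype F] [DecidableEq F] [DecidableEq V]

/-- The correlation of two spheres, for a form whose Gauss sums all have the value `g`. -/
theorem sum_centeredIndicator_mul (Q : QuadraticForm F V) {ψ : AddChar F ℂ}
    (hψ : ψ.IsPrimitive) {g : ℝ} (hG : ∀ k : F, k ≠ 0 → ∑ x, ψ (k * Q x) = g)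
    (hN : ∀ v : V, v ≠ 0 → ∃ w, QuadraticMap.polar Q w v ≠ 0) (c c' : V) (r r' : F) :
    ∑ x, centeredIndicator (Q (x - c) - r) * centeredIndicator (Q (x - c') - r')
      = g * ∑ w ∈ (univ.erase (0 : F)).erase (-1),
          centeredIndicator (w / (1 + w) * Q (c - c') - r - w * r')
        + if c = c' then Fintype.card V * centeredIndicator (r' - r) else 0 := by
  apply Complex.ofReal_injective
  rw [Complex.ofReal_sum]
  simp_rw [centeredIndicator_mul_eq_sum hψ]
  rw [Finset.sum_comm]
  have hmem : (-1 : F) ∈ univ.erase (0 : F) := by simp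
  rw [← Finset.sum_erase_add _ _ hmem]
  push_cast
  congr 1
  · rw [Finset.mul_sum]
    refine Finset.sum_congr rfl fun w hw => ?_
    have hw1 : 1 + w ≠ 0 := fun h =>
      Finset.ne_of_mem_erase hw (by linear_combination h)
    rw [Finset.sum_comm, ← sum_erase_addChar_mul hψ, Finset.mul_sum]
    exact Finset.sum_congr rfl fun m hm =>
      sum_addChar_pencil Q hG c c' r r' (Finset.ne_of_mem_erase hm) hw1
  · rw [Finset.sum_comm]
    split_ifs with hc
    · subst hc
      push_cast
      rw [← sum_erase_addChar_mul hψ, Finset.mul_sum]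
      refine Finset.sum_congr rfl fun m _ => ?_
      simp
    · rw [Complex.ofReal_zero]
      exact Finset.sum_eq_zero fun m hm =>
        sum_addChar_sub hψ Q hN hc r r' (Finset.ne_of_mem_erase hm)

theorem sum_centeredIndicator_mul_le (Q : QuadraticForm F V) {ψ : AddChar F ℂ}
    (hψ : ψ.IsPrimitive) {g : ℝ} (hG : ∀ k : F, k ≠ 0 → ∑ x, ψ (k * Q x) = g)
    (hN : ∀ v : V, v ≠ 0 → ∃ w, QuadraticMap.polar Q w v ≠ 0) (s t : V × F) (ht : t.2 ≠ 0) :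
    ∑ x, centeredIndicator (Q (x - s.1) - s.2) * centeredIndicator (Q (x - t.1) - t.2)
      ≤ |g| * (Fintype.card F + 2)
        + if s = t then (Fintype.card V : ℝ) * Fintype.card F else 0 := by
  rw [sum_centeredIndicator_mul Q hψ hG hN]
  refine add_le_add ?_ ?_
  · refine (le_abs_self _).trans ?_
    rw [abs_mul]
    exact mul_le_mul_of_nonneg_left (abs_sum_centeredIndicator_le _ _ ht) (abs_nonneg g)
  · by_cases h1 : s.1 = t.1
    · by_cases h2 : s.2 = t.2
      · rw [if_pos h1, if_pos (Prod.ext h1 h2), h2, sub_self, centeredIndicator, if_pos rfl]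
        gcongr
        linarith
      · have h3 : t.2 - s.2 ≠ 0 := sub_ne_zero.mpr (Ne.symm h2)
        rw [if_pos h1, if_neg (fun h => h2 (congrArg Prod.snd h)), centeredIndicator, if_neg h3]
        have : (0 : ℝ) ≤ Fintype.card V := Nat.cast_nonneg _
        linarith
    · rw [if_neg h1, if_neg (fun h => h1 (congrArg Prod.fst h))]

/-- Incidence bound for spheres of non-zero radius with respect to a non-degenerate quadratic form
whose Gauss sums all have the value `g`. -/
theorem sq_incidences_sub_le (Q : QuadraticForm F V) {ψ : AddChar F ℂ}
    (hψ : ψ.IsPrimitive) {g : ℝ} (hG : ∀ k : F, k ≠ 0 → ∑ x, ψ (k * Q x) = g)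
    (hN : ∀ v : V, v ≠ 0 → ∃ w, QuadraticMap.polar Q w v ≠ 0)
    (P : Finset V) (S : Finset (V × F)) (hS : ∀ s ∈ S, s.2 ≠ 0) :
    ((Fintype.card F : ℝ) * ((P ×ˢ S).filter fun z => Q (z.1 - z.2.1) = z.2.2).card
        - P.card * S.card) ^ 2
      ≤ P.card * (|g| * (Fintype.card F + 2) * (S.card : ℝ) ^ 2
          + Fintype.card V * Fintype.card F * S.card) := by
  have hI : (Fintype.card F : ℝ) * ((P ×ˢ S).filter fun z => Q (z.1 - z.2.1) = z.2.2).card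
        - P.card * S.card
      = ∑ x ∈ P, ∑ s ∈ S, centeredIndicator (Q (x - s.1) - s.2) := by
    rw [← Finset.sum_product (f := fun z : V × V × F =>
      centeredIndicator (Q (z.1 - z.2.1) - z.2.2))]
    simp only [centeredIndicator, sub_eq_zero]
    rw [Finset.sum_sub_distrib, ← Finset.sum_filter, Finset.sum_const, Finset.sum_const,
      Finset.card_product]
    simp only [nsmul_eq_mul]
    push_cast
    ring
  rw [hI]
  refine sq_sum_le_card_mul_sum_sq.trans (mul_le_mul_of_nonneg_left ?_ (Nat.cast_nonneg _))
  calc ∑ x ∈ P, (∑ s ∈ S, centeredIndicator (Q (x - s.1) - s.2)) ^ 2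
      ≤ ∑ x, (∑ s ∈ S, centeredIndicator (Q (x - s.1) - s.2)) ^ 2 :=
        Finset.sum_le_sum_of_subset_of_nonneg (Finset.subset_univ _) fun _ _ _ => sq_nonneg _
    _ = ∑ s ∈ S, ∑ t ∈ S, ∑ x, centeredIndicator (Q (x - s.1) - s.2)
          * centeredIndicator (Q (x - t.1) - t.2) := by
        simp_rw [sq, Finset.sum_mul_sum]
        rw [Finset.sum_comm]
        exact Finset.sum_congr rfl fun s _ => Finset.sum_comm
    _ ≤ ∑ s ∈ S, ∑ t ∈ S, (|g| * (Fintype.card F + 2)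
          + if s = t then (Fintype.card V : ℝ) * Fintype.card F else 0) :=
        Finset.sum_le_sum fun s _ => Finset.sum_le_sum fun t ht =>
          sum_centeredIndicator_mul_le Q hψ hG hN s t (hS t ht)
    _ = _ := by
        simp only [Finset.sum_add_distrib, Finset.sum_const, Finset.sum_ite_eq, nsmul_eq_mul]
        rw [Finset.sum_ite_mem, Finset.inter_self, Finset.sum_const, nsmul_eq_mul]
        ring

end SphereIncidences

section BinaryForms

variable {F : Type*} [Field F]

/-- The hyperbolic plane `xy`. -/
def hyperbolicPlane (F : Type*) [Field F] : QuadraticForm F (F × F) :=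
  QuadraticMap.linMulLin (LinearMap.fst F F F) (LinearMap.snd F F F)

/-- The binary form `x² − a y²`. -/
def normPlane (a : F) : QuadraticForm F (F × F) :=
  QuadraticMap.linMulLin (LinearMap.fst F F F) (LinearMap.fst F F F)
    - a • QuadraticMap.linMulLin (LinearMap.snd F F F) (LinearMap.snd F F F)

@[simp]
theorem hyperbolicPlane_apply (p : F × F) : hyperbolicPlane F p = p.1 * p.2 := rfl

@[simp]
theorem normPlane_apply (a : F) (p : F × F) : normPlane a p = p.1 ^ 2 - a * p.2 ^ 2 := by
  simp [normPlane, sq]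

theorem hyperbolicPlane_exists_polar_ne_zero {v : F × F} (hv : v ≠ 0) :
    ∃ w, QuadraticMap.polar (hyperbolicPlane F) w v ≠ 0 := by
  by_contra! h
  apply hv
  have h1 := h (1, 0)
  have h2 := h (0, 1)
  simp only [QuadraticMap.polar, hyperbolicPlane_apply, Prod.fst_add, Prod.snd_add] at h1 h2
  ext
  · simp only [Prod.fst_zero]
    linear_combination h2
  · simp only [Prod.snd_zero]
    linear_combination h1

theorem normPlane_exists_polar_ne_zero (h2 : (2 : F) ≠ 0) {a : F} (ha : a ≠ 0)
    {v : F × F} (hv : v ≠ 0) : ∃ w, QuadraticMap.polar (normPlane a) w v ≠ 0 := by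
  by_contra! h
  apply hv
  have h3 := h (1, 0)
  have h4 := h (0, 1)
  simp only [QuadraticMap.polar, normPlane_apply, Prod.fst_add, Prod.snd_add] at h3 h4
  ext
  · refine (mul_eq_zero.mp (?_ : 2 * v.1 = 0)).resolve_left h2
    linear_combination h3
  · refine (mul_eq_zero.mp (?_ : 2 * a * v.2 = 0)).resolve_left (mul_ne_zero h2 ha)
    linear_combination -h4

theorem normPlane_anisotropic {a : F} (ha : ¬ IsSquare a) {p : F × F} (hp : normPlane a p = 0) :
    p = 0 := by
  rw [normPlane_apply] at hp
  have h2 : p.2 = 0 := by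
    by_contra h
    refine ha ⟨p.1 / p.2, ?_⟩
    field_simp
    linear_combination -hp
  have h1 : p.1 = 0 := by
    rw [h2] at hp
    exact pow_eq_zero_iff two_ne_zero |>.mp (by linear_combination hp)
  exact Prod.ext h1 h2

variable [Fintype F]

theorem exists_normPlane_eq (hodd : Odd (Fintype.card F)) {a : F} (ha : a ≠ 0) (k : F) :
    ∃ z, normPlane a z = k := by
  obtain ⟨x, y, hxy⟩ := FiniteField.exists_root_sum_quadratic
    (f := Polynomial.X ^ 2 - Polynomial.C k) (g := Polynomial.C (-a) * Polynomial.X ^ 2)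
    (Polynomial.degree_X_pow_sub_C two_pos k)
    (Polynomial.degree_C_mul_X_pow 2 (neg_ne_zero.mpr ha)) (Nat.odd_iff.mp hodd)
  refine ⟨(x, y), ?_⟩
  simp only [Polynomial.eval_sub, Polynomial.eval_pow, Polynomial.eval_X, Polynomial.eval_C,
    Polynomial.eval_mul] at hxy
  rw [normPlane_apply]
  linear_combination hxy

/-- Gauss sums of the norm form do not depend on the scaling, as the norm form is multiplicative
and represents every scalar. -/
theorem sum_addChar_normPlane_scale (hodd : Odd (Fintype.card F)) (ψ : AddChar F ℂ) {a : F}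
    (ha : a ≠ 0) {k : F} (hk : k ≠ 0) :
    ∑ p, ψ (k * normPlane a p) = ∑ p, ψ (normPlane a p) := by
  obtain ⟨z, hz⟩ := exists_normPlane_eq hodd ha k
  rw [normPlane_apply] at hz
  have hinj : Function.Injective fun p : F × F =>
      (z.1 * p.1 + a * z.2 * p.2, z.1 * p.2 + z.2 * p.1) := by
    intro p p' h
    obtain ⟨h1, h2⟩ := Prod.mk.inj h
    ext
    · apply mul_left_cancel₀ hk
      linear_combination (p'.1 - p.1) * hz + z.1 * h1 - a * z.2 * h2
    · apply mul_left_cancel₀ hk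
      linear_combination (p'.2 - p.2) * hz + z.1 * h2 - z.2 * h1
  rw [← (Finite.injective_iff_bijective.mp hinj).sum_comp fun p => ψ (normPlane a p)]
  refine Finset.sum_congr rfl fun p _ => congrArg ψ ?_
  simp only [normPlane_apply]
  linear_combination -(p.1 ^ 2 - a * p.2 ^ 2) * hz

variable [DecidableEq F]

theorem sum_addChar_hyperbolicPlane {ψ : AddChar F ℂ} (hψ : ψ.IsPrimitive) {k : F} (hk : k ≠ 0) :
    ∑ p, ψ (k * hyperbolicPlane F p) = Fintype.card F := by
  rw [Fintype.sum_prod_type_right]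
  have h : ∀ y : F, ∑ x, ψ (k * hyperbolicPlane F (x, y))
      = if y = 0 then (Fintype.card F : ℂ) else 0 := fun y => by
    have h1 := AddChar.sum_mulShift (k * y) hψ
    simp only [mul_eq_zero, hk, false_or] at h1
    push_cast at h1
    rw [← h1]
    refine Finset.sum_congr rfl fun x _ => congrArg ψ ?_
    rw [hyperbolicPlane_apply]
    ring
  simp_rw [h]
  simp

theorem sum_addChar_normPlane (hodd : Odd (Fintype.card F)) {ψ : AddChar F ℂ}
    (hψ : ψ.IsPrimitive) {a : F} (ha : ¬ IsSquare a) {k : F} (hk : k ≠ 0) :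
    ∑ p, ψ (k * normPlane a p) = -Fintype.card F := by
  have ha0 : a ≠ 0 := by
    rintro rfl
    exact ha IsSquare.zero
  have hscale := fun {m : F} (hm : m ≠ 0) => sum_addChar_normPlane_scale hodd ψ ha0 hm
  rw [hscale hk]
  set W := ∑ p, ψ (normPlane a p)
  have htotal : ∑ m : F, ∑ p, ψ (m * normPlane a p) = Fintype.card F := by
    rw [Finset.sum_comm]
    have h : ∀ p, ∑ m : F, ψ (m * normPlane a p)
        = if p = 0 then (Fintype.card F : ℂ) else 0 := fun p => by
      rw [AddChar.sum_mulShift _ hψ]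
      by_cases hp : p = 0
      · simp [hp]
      · rw [if_neg hp, if_neg fun h => hp (normPlane_anisotropic ha h), Nat.cast_zero]
    simp_rw [h]
    simp
  rw [← Finset.sum_erase_add _ _ (mem_univ (0 : F)),
    Finset.sum_congr rfl fun m hm => hscale (Finset.ne_of_mem_erase hm), Finset.sum_const,
    Finset.card_erase_of_mem (mem_univ _), Finset.card_univ, nsmul_eq_mul,
    Nat.cast_sub Fintype.card_pos] at htotal
  simp only [zero_mul, AddChar.map_zero_eq_one, Finset.sum_const, Finset.card_univ,
    Fintype.card_prod, nsmul_eq_mul, mul_one] at htotal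
  push_cast at htotal
  have hq : (Fintype.card F : ℂ) - 1 ≠ 0 := by
    rw [sub_ne_zero]
    exact_mod_cast Fintype.one_lt_card.ne'
  apply mul_left_cancel₀ hq
  linear_combination htotal

end BinaryForms

section OrthogonalSums

variable {F ι : Type*} [Field F] [Fintype ι] [DecidableEq ι]
  {M : ι → Type*} [∀ j, AddCommGroup (M j)] [∀ j, Module F (M j)]

theorem exists_polar_pi_ne_zero (B : ∀ j, QuadraticForm F (M j))
    (hB : ∀ j (v : M j), v ≠ 0 → ∃ w, QuadraticMap.polar (B j) w v ≠ 0)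
    {v : ∀ j, M j} (hv : v ≠ 0) : ∃ w, QuadraticMap.polar (QuadraticMap.pi B) w v ≠ 0 := by
  obtain ⟨j, hj⟩ := Function.ne_iff.mp hv
  obtain ⟨w, hw⟩ := hB j (v j) hj
  refine ⟨Pi.single j w, ?_⟩
  have h : QuadraticMap.polar (QuadraticMap.pi B) (Pi.single j w) v
      = QuadraticMap.polar (B j) w (v j) := by
    simp only [QuadraticMap.polar, QuadraticMap.pi_apply, Pi.add_apply]
    rw [← Finset.sum_sub_distrib, ← Finset.sum_sub_distrib, Finset.sum_eq_single j]
    · rw [Pi.single_eq_same]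
    · intro l _ hl
      simp [Pi.single_eq_of_ne hl]
    · simp
  rwa [h]

theorem sum_addChar_pi [∀ j, Fintype (M j)] (ψ : AddChar F ℂ) (B : ∀ j, QuadraticForm F (M j))
    (k : F) :
    ∑ x, ψ (k * QuadraticMap.pi B x) = ∏ j, ∑ p, ψ (k * B j p) := by
  rw [Finset.prod_univ_sum, Fintype.piFinset_univ]
  refine Finset.sum_congr rfl fun x _ => ?_
  rw [QuadraticMap.pi_apply, Finset.mul_sum]
  exact map_prod ψ.toMonoidHom _ _

end OrthogonalSums

section Coordinates

variable {F : Type*} [Field F]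

/-- Grouping `2m` coordinates into `m` consecutive pairs. -/
def coordPairs (F : Type*) [Field F] (m : ℕ) : (Fin (2 * m) → F) ≃ₗ[F] (Fin m → F × F) where
  toFun x j := (x ⟨2 * j, by omega⟩, x ⟨2 * j + 1, by omega⟩)
  invFun p l := if l.1 % 2 = 0 then (p ⟨l.1 / 2, by omega⟩).1 else (p ⟨l.1 / 2, by omega⟩).2
  map_add' _ _ := rfl
  map_smul' _ _ := rfl
  left_inv x := by
    ext l
    dsimp only
    split_ifs with h
    · exact congrArg x (Fin.ext (by dsimp only; omega))
    · exact congrArg x (Fin.ext (by dsimp only; omega))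
  right_inv p := by
    funext j
    have h1 : (2 * (j : ℕ)) % 2 = 0 := by omega
    have h2 : ¬ (2 * (j : ℕ) + 1) % 2 = 0 := by omega
    have h3 : 2 * (j : ℕ) / 2 = j := by omega
    have h4 : (2 * (j : ℕ) + 1) / 2 = j := by omega
    simp only [h1, h2, h3, h4, if_true, if_false]

theorem pairsForm_eq_sum {m k : ℕ} (hk : k ≤ m) (x : Fin (2 * m) → F) :
    pairsForm k x = ∑ j : Fin k, hyperbolicPlane F (coordPairs F m x (Fin.castLE hk j)) := by
  rw [pairsForm, Finset.sum_range]
  refine Finset.sum_congr rfl fun j _ => ?_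
  rw [dif_pos (by omega)]
  rfl

theorem Q1form_eq_pi {m : ℕ} (x : Fin (2 * m) → F) :
    Q1form x = QuadraticMap.pi (fun _ : Fin m => hyperbolicPlane F) (coordPairs F m x) := by
  have hm : 2 * m / 2 = m := by omega
  rw [Q1form, QuadraticMap.pi_apply, hm, pairsForm_eq_sum le_rfl]
  rfl

theorem Q2form_eq_pi (a : F) {n : ℕ} (x : Fin (2 * (n + 1)) → F) :
    Q2form a x = QuadraticMap.pi
      (fun j : Fin (n + 1) => if j = Fin.last n then normPlane a else hyperbolicPlane F)
      (coordPairs F (n + 1) x) := by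
  have hn : (2 * (n + 1) - 2) / 2 = n := by omega
  rw [Q2form, QuadraticMap.pi_apply, hn, pairsForm_eq_sum n.le_succ, Fin.sum_univ_castSucc,
    dif_pos (by omega)]
  congr 1
  · refine Finset.sum_congr rfl fun j _ => ?_
    rw [if_neg (Fin.castSucc_lt_last j).ne]
    rfl
  · rw [if_pos rfl, normPlane_apply]
    rfl

variable [Fintype F] [DecidableEq F]

/-- Incidence bound for orthogonal sums of binary forms with Gauss sums of absolute value `q`. -/
theorem sq_incidences_pi_sub_le {m : ℕ} {ψ : AddChar F ℂ} (hψ : ψ.IsPrimitive)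
    (B : Fin m → QuadraticForm F (F × F)) (g : Fin m → ℝ)
    (hg : ∀ j, |g j| = Fintype.card F)
    (hG : ∀ j (k : F), k ≠ 0 → ∑ p, ψ (k * B j p) = g j)
    (hN : ∀ j v, v ≠ 0 → ∃ w, QuadraticMap.polar (B j) w v ≠ 0)
    (P : Finset (Fin (2 * m) → F)) (S : Finset ((Fin (2 * m) → F) × F)) (hS : ∀ s ∈ S, s.2 ≠ 0) :
    ((Fintype.card F : ℝ)
          * sphIncid (fun x => QuadraticMap.pi B (coordPairs F m x)) P S - P.card * S.card) ^ 2
      ≤ P.card * ((Fintype.card F : ℝ) ^ m * (Fintype.card F + 2) * (S.card : ℝ) ^ 2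
          + (Fintype.card F : ℝ) ^ (2 * m) * Fintype.card F * S.card) := by
  set Q : QuadraticForm F (Fin (2 * m) → F) :=
    (QuadraticMap.pi B).comp (coordPairs F m).toLinearMap
  have hQ : ∀ x, Q x = QuadraticMap.pi B (coordPairs F m x) := fun _ => rfl
  have hQG : ∀ k : F, k ≠ 0 → ∑ x, ψ (k * Q x) = (∏ j, g j : ℝ) := fun k hk => by
    simp_rw [hQ]
    rw [(coordPairs F m).bijective.sum_comp fun p => ψ (k * QuadraticMap.pi B p), sum_addChar_pi]
    push_cast
    exact Finset.prod_congr rfl fun j _ => hG j k hk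
  have hQN : ∀ v, v ≠ 0 → ∃ w, QuadraticMap.polar Q w v ≠ 0 := fun v hv => by
    obtain ⟨w, hw⟩ := exists_polar_pi_ne_zero B hN
      ((coordPairs F m).map_ne_zero_iff.mpr hv)
    refine ⟨(coordPairs F m).symm w, ?_⟩
    simpa [QuadraticMap.polar, hQ] using hw
  have habs : |∏ j, g j| = (Fintype.card F : ℝ) ^ m := by
    rw [Finset.abs_prod, Finset.prod_congr rfl fun j _ => hg j]
    simp
  have h := sq_incidences_sub_le Q hψ hQG hQN P S hS
  rw [habs, Fintype.card_fun, Fintype.card_fin, Nat.cast_pow] at h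
  exact h

theorem sq_sphIncid_Qi_sub_le (hodd : Odd (Fintype.card F)) {a : F} (ha : ¬ IsSquare a)
    {i : ℕ} (hi : i = 1 ∨ i = 2) {m : ℕ} (hm : 0 < m)
    (P : Finset (Fin (2 * m) → F)) (S : Finset ((Fin (2 * m) → F) × F)) (hS : ∀ s ∈ S, s.2 ≠ 0) :
    ((Fintype.card F : ℝ) * sphIncid (Qi a i) P S - P.card * S.card) ^ 2
      ≤ P.card * ((Fintype.card F : ℝ) ^ m * (Fintype.card F + 2) * (S.card : ℝ) ^ 2
          + (Fintype.card F : ℝ) ^ (2 * m) * Fintype.card F * S.card) := by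
  have hψ := AddChar.FiniteField.primitiveChar_to_Complex_isPrimitive F
  rcases hi with rfl | rfl
  · have hQ : (Qi a 1 : (Fin (2 * m) → F) → F)
        = fun x => QuadraticMap.pi (fun _ => hyperbolicPlane F) (coordPairs F m x) :=
      funext fun x => by rw [Qi, if_pos rfl, Q1form_eq_pi]
    rw [hQ]
    refine sq_incidences_pi_sub_le hψ _ (fun _ => Fintype.card F) (fun _ => by simp) ?_ ?_ P S hS
    · intro j k hk
      simpa using sum_addChar_hyperbolicPlane hψ hk
    · exact fun _ _ => hyperbolicPlane_exists_polar_ne_zero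
  · obtain ⟨n, rfl⟩ := Nat.exists_eq_succ_of_ne_zero hm.ne'
    have hQ : (Qi a 2 : (Fin (2 * (n + 1)) → F) → F) = fun x => QuadraticMap.pi
        (fun j : Fin (n + 1) => if j = Fin.last n then normPlane a else hyperbolicPlane F)
        (coordPairs F (n + 1) x) :=
      funext fun x => by rw [Qi, if_neg (by norm_num), if_pos rfl, Q2form_eq_pi]
    rw [hQ]
    refine sq_incidences_pi_sub_le hψ _
      (fun j => if j = Fin.last n then -(Fintype.card F : ℝ) else Fintype.card F)
      (fun j => by split_ifs <;> simp) ?_ ?_ P S hS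
    · intro j k hk
      split_ifs
      · simpa using sum_addChar_normPlane hodd hψ ha hk
      · simpa using sum_addChar_hyperbolicPlane hψ hk
    · intro j v hv
      split_ifs
      · have h2 : (2 : F) ≠ 0 := Ring.two_ne_zero fun h => by
          have := FiniteField.even_card_iff_char_two.mp h
          have := Nat.odd_iff.mp hodd
          omega
        have ha0 : a ≠ 0 := by
          rintro rfl
          exact ha IsSquare.zero
        exact normPlane_exists_polar_ne_zero h2 ha0 hv
      · exact hyperbolicPlane_exists_polar_ne_zero hv

end Coordinates

/-- Incidence bound for non-zero-radius `Q_i^d`-spheres (`i ∈ {1,2}`, even `d`),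
for all sufficiently large odd prime powers `q`. -/
theorem stmt3 (d : ℕ) (hd : 4 ≤ d) (hdeven : Even d)
    (i : ℕ) (hi : i = 1 ∨ i = 2) :
    ∀ ε : ℝ, 0 < ε → ∃ q₀ : ℕ,
      ∀ (F : Type) [Field F] [Fintype F] [DecidableEq F],
        Odd (Fintype.card F) → q₀ ≤ Fintype.card F →
        ∀ (a : F), ¬ IsSquare a →
        ∀ (P : Finset (Fin d → F)) (S : Finset ((Fin d → F) × F)),
          (∀ s ∈ S, s.2 ≠ 0) →
          |(sphIncid (Qi a i) P S : ℝ) - (Fintype.card F : ℝ)⁻¹ * P.card * S.card|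
            ≤ (1 + ε) * Real.sqrt ((P.card : ℝ) *
                ((Fintype.card F : ℝ) ^ (d-1) * S.card
                  + (Fintype.card F : ℝ) ^ (d/2-1) * (S.card : ℝ) ^ 2)) := by
  intro ε hε
  refine ⟨⌈2 / ε⌉₊, fun F _ _ _ hodd hq a ha P S hS => ?_⟩
  obtain ⟨n, rfl⟩ : ∃ n, d = 2 * (n + 1) := by
    obtain ⟨r, hr⟩ := hdeven
    exact ⟨r - 1, by omega⟩
  have hbound := sq_sphIncid_Qi_sub_le hodd ha hi n.succ_pos P S hS
  have he1 : 2 * (n + 1) - 1 = 2 * n + 1 := by omega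
  have he2 : 2 * (n + 1) / 2 - 1 = n := by omega
  rw [he1, he2]
  set q := (Fintype.card F : ℝ)
  have hq0 : 0 < q := Nat.cast_pos.mpr Fintype.card_pos
  have hqε : 2 ≤ ε * q := by
    have h := (Nat.ceil_le.mp hq : 2 / ε ≤ q)
    rwa [div_le_iff₀' hε] at h
  set I := (sphIncid (Qi a i) P S : ℝ)
  set p := (P.card : ℝ)
  set s := (S.card : ℝ)
  have hp : 0 ≤ p := Nat.cast_nonneg _
  have hs : 0 ≤ s := Nat.cast_nonneg _
  have hmain : (I - q⁻¹ * p * s) ^ 2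
      ≤ (1 + ε) ^ 2 * (p * (q ^ (2 * n + 1) * s + q ^ n * s ^ 2)) := by
    have hscale : (q * I - p * s) ^ 2 = q ^ 2 * (I - q⁻¹ * p * s) ^ 2 := by
      field_simp
    rw [hscale] at hbound
    refine le_of_mul_le_mul_left (hbound.trans ?_) (pow_pos hq0 2)
    have h1 : q + 2 ≤ (1 + ε) ^ 2 * q := by nlinarith
    have h2 : (1 : ℝ) ≤ (1 + ε) ^ 2 := by nlinarith
    calc p * (q ^ (n + 1) * (q + 2) * s ^ 2 + q ^ (2 * (n + 1)) * q * s)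
        ≤ p * (q ^ (n + 1) * ((1 + ε) ^ 2 * q) * s ^ 2
            + (1 + ε) ^ 2 * (q ^ (2 * (n + 1)) * q * s)) := by
          refine mul_le_mul_of_nonneg_left (add_le_add ?_ ?_) hp
          · gcongr
          · exact le_mul_of_one_le_left (by positivity) h2
      _ = q ^ 2 * ((1 + ε) ^ 2 * (p * (q ^ (2 * n + 1) * s + q ^ n * s ^ 2))) := by ring
  refine (Real.abs_le_sqrt hmain).trans_eq ?_
  rw [Real.sqrt_mul (sq_nonneg _), Real.sqrt_sq (by linarith)]
end
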